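/- arXiv:1005.2863 — 2 statements merged into one kernel-verified Lean document; each statement's English description precedes it below -/
import Mathlib

section
/- Let G(n) denote the number of 2-SAT functions of n Boolean variables. Then G(n) = (1+o(1))·2^{n(n+1)/2}; that is, G(n)/2^{n(n+1)/2} → 1 as n → ∞. -/
open Filter

noncomputable section

/-- A literal is a pair (variable index, polarity): `(i, b)` is satisfied by an
assignment `a` iff `a i = b`. -/
abbrev Literal (n : ℕ) := Fin n × Bool

/-- A Boolean function `f` of `n` variables is a 2-SAT function if it is defined by
some 2-SAT formula, i.e. a nonempty conjunction of clauses `y ∨ y'` with `y, y'`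
literals of two distinct variables. -/
def IsTwoSATFunction {n : ℕ} (f : (Fin n → Bool) → Bool) : Prop :=
  ∃ Cs : Finset (Literal n × Literal n),
    Cs.Nonempty ∧ (∀ c ∈ Cs, c.1.1 ≠ c.2.1) ∧
    ∀ a : Fin n → Bool, (f a = true ↔ ∀ c ∈ Cs, a c.1.1 = c.1.2 ∨ a c.2.1 = c.2.2)

/-- `G(n)`: the number of 2-SAT functions of `n` Boolean variables. -/
def Gnum (n : ℕ) : ℕ := {f : (Fin n → Bool) → Bool | IsTwoSATFunction f}.ncard

namespace TwoSat

open Finset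

open scoped Classical

/-! ### Structures: irredundant elementary formulas -/

/-- Clause (or no clause) carried by an ordered pair of variables. -/
abbrev O := Option (Bool × Bool)

/-- A formula with at most one clause on each pair of variables. -/
abbrev St (n : ℕ) := Fin n → Fin n → O

/-- The assignment `σ` satisfies the formula `c`. -/
def Sat {n : ℕ} (c : St n) (σ : Fin n → Bool) : Prop :=
  ∀ u w a b, c u w = some (a, b) → σ u = a ∨ σ w = b

/-- Irredundant formulas defining an elementary function, with variables in `A`. -/
structure Good {n : ℕ} (A : Finset (Fin n)) (c : St n) : Prop where
  sym : ∀ u w a b, c u w = some (a, b) → c w u = some (b, a)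
  irr : ∀ u, c u u = none
  supp : ∀ u w a b, c u w = some (a, b) → u ∈ A
  free : ∀ i ∈ A, ∀ a, ∃ σ, Sat c σ ∧ σ i = a
  noneq : ∀ i ∈ A, ∀ j ∈ A, i ≠ j → ∀ b, ∃ σ, Sat c σ ∧ xor (σ i) (σ j) = b
  irred : ∀ u w a b, c u w = some (a, b) → ∃ σ : Fin n → Bool, σ u = !a ∧ σ w = !b ∧
    ∀ u' w' a' b', c u' w' = some (a', b') → ¬ (u' = u ∧ w' = w) → ¬ (u' = w ∧ w' = u) →
      σ u' = a' ∨ σ w' = b'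

/-- The finite set of all structures on `A`. -/
def CC {n : ℕ} (A : Finset (Fin n)) : Finset (St n) := univ.filter (Good A)

lemma mem_CC {n : ℕ} {A : Finset (Fin n)} {c : St n} : c ∈ CC A ↔ Good A c := by
  simp [CC]

/-- Delete the variables in `S`. -/
def restr {n : ℕ} (S : Finset (Fin n)) (c : St n) : St n :=
  fun u w => if u ∈ S ∨ w ∈ S then none else c u w

lemma restr_some {n : ℕ} {S : Finset (Fin n)} {c : St n} {u w a b} :
    restr S c u w = some (a, b) ↔ u ∉ S ∧ w ∉ S ∧ c u w = some (a, b) := by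
  unfold restr
  split_ifs with h
  · simp; tauto
  · push Not at h; simp [h]

lemma Good.restr {n : ℕ} {A : Finset (Fin n)} {c : St n} (h : Good A c) (S : Finset (Fin n)) :
    Good (A \ S) (restr S c) := by
  have hs : ∀ σ, Sat c σ → Sat (TwoSat.restr S c) σ := by
    intro σ hσ u w a b hc
    exact hσ u w a b (restr_some.1 hc).2.2
  refine ⟨?_, ?_, ?_, ?_, ?_, ?_⟩
  · intro u w a b hc
    rw [restr_some] at hc ⊢
    exact ⟨hc.2.1, hc.1, h.sym _ _ _ _ hc.2.2⟩
  · intro u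
    simp [TwoSat.restr, h.irr]
  · intro u w a b hc
    rw [restr_some] at hc
    exact mem_sdiff.2 ⟨h.supp _ _ _ _ hc.2.2, hc.1⟩
  · intro i hi a
    obtain ⟨σ, h1, h2⟩ := h.free i (mem_sdiff.1 hi).1 a
    exact ⟨σ, hs σ h1, h2⟩
  · intro i hi j hj hij b
    obtain ⟨σ, h1, h2⟩ := h.noneq i (mem_sdiff.1 hi).1 j (mem_sdiff.1 hj).1 hij b
    exact ⟨σ, hs σ h1, h2⟩
  · intro u w a b hc
    obtain ⟨σ, h1, h2, h3⟩ := h.irred u w a b (restr_some.1 hc).2.2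
    exact ⟨σ, h1, h2, fun u' w' a' b' hc' => h3 u' w' a' b' (restr_some.1 hc').2.2⟩

lemma Good.supp2 {n : ℕ} {A : Finset (Fin n)} {c : St n} (h : Good A c) {u w a b}
    (hc : c u w = some (a, b)) : w ∈ A := h.supp _ _ _ _ (h.sym _ _ _ _ hc)

lemma Good.ne {n : ℕ} {A : Finset (Fin n)} {c : St n} (h : Good A c) {u w a b}
    (hc : c u w = some (a, b)) : u ≠ w := by
  rintro rfl
  simp [h.irr] at hc

lemma bool_aux1 : ∀ a d e g x y : Bool, e ≠ a → g ≠ d → (x = a ∨ y = d) ∧ (x = e ∨ y = g) →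
    xor x y = xor a d → False := by decide

lemma bool_aux2 : ∀ a b x y : Bool, (x = a ∨ y = b) → xor x y = xor a b → x = a ∧ y = b := by
  decide

/-- Two clauses with opposite literals at `v` exclude the third side of the triangle. -/
lemma Good.tri {n : ℕ} {A : Finset (Fin n)} {c : St n} (h : Good A c) {u v w a b b' d}
    (h1 : c u v = some (a, b)) (h2 : c v w = some (b', d)) (hb : b ≠ b') : c u w = none := by
  by_contra hne
  obtain ⟨⟨e, g⟩, h3⟩ := Option.ne_none_iff_exists'.1 hne
  have huv := h.ne h1
  have hvw := h.ne h2
  have huw := h.ne h3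
  have key : ∀ σ, Sat c σ → (σ u = a ∨ σ w = d) ∧ (σ u = e ∨ σ w = g) := by
    intro σ hσ
    have e1 := hσ _ _ _ _ h1
    have e2 := hσ _ _ _ _ h2
    refine ⟨?_, hσ _ _ _ _ h3⟩
    by_contra hh
    push Not at hh
    exact hb ((e1.resolve_left hh.1).symm.trans (e2.resolve_right hh.2))
  by_cases hea : e = a
  · by_cases hgd : g = d
    · subst hea hgd
      obtain ⟨σ, s1, s2, s3⟩ := h.irred _ _ _ _ h3
      have e1 := s3 _ _ _ _ h1 (by tauto) (by tauto)
      have e2 := s3 _ _ _ _ h2 (by tauto) (by tauto)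
      rw [s1] at e1
      rw [s2] at e2
      simp at e1 e2
      exact hb (e1.symm.trans e2)
    · obtain ⟨σ, s1, s2⟩ := h.free u (h.supp _ _ _ _ h1) (!a)
      have := key σ s1
      rw [s2, hea] at this
      simp at this
      exact hgd (this.2.symm.trans this.1)
  · by_cases hgd : g = d
    · obtain ⟨σ, s1, s2⟩ := h.free w (h.supp2 h2) (!d)
      have := key σ s1
      rw [s2, hgd] at this
      simp at this
      exact hea (this.2.symm.trans this.1)
    · obtain ⟨σ, s1, s2⟩ := h.noneq u (h.supp _ _ _ _ h1) w (h.supp2 h2) huw (xor a d)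
      have := key σ s1
      exact bool_aux1 _ _ _ _ _ _ hea hgd this s2

/-- The ranking of the literals: the clause between `u` and `w` uses the preferred literal
of the vertex of larger rank. -/
lemma Good.ord {n : ℕ} {A : Finset (Fin n)} {c : St n} (h : Good A c) :
    ∃ (s : Fin n → Bool) (κ : Fin n → ℕ), ∀ u w a b, c u w = some (a, b) → κ u ≤ κ w →
      b = s w := by
  let μ : Fin n → Bool → ℕ := fun u a => (univ.filter (fun σ => Sat c σ ∧ σ u = a)).card
  have htot : ∀ u a, μ u a + μ u (!a) = (univ.filter (fun σ : Fin n → Bool => Sat c σ)).card := by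
    intro u a
    rw [← Finset.card_filter_add_card_filter_not (s := univ.filter (fun σ => Sat c σ))
      (fun σ : Fin n → Bool => σ u = a)]
    simp only [μ, filter_filter]
    congr 3
    ext σ
    simp [Bool.eq_not]
  have hlt : ∀ u w a b, c u w = some (a, b) → μ u (!a) < μ w b := by
    intro u w a b hc
    obtain ⟨σ, s1, s2⟩ := h.noneq u (h.supp _ _ _ _ hc) w (h.supp2 hc) (h.ne hc) (xor a b)
    apply Finset.card_lt_card
    rw [Finset.ssubset_iff_of_subset]
    · have := bool_aux2 _ _ _ _ (s1 _ _ _ _ hc) s2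
      refine ⟨σ, ?_, ?_⟩
      · simp [s1, this.2]
      · simp [this.1]
    · intro σ hσ
      simp only [mem_filter, mem_univ, true_and] at hσ ⊢
      refine ⟨hσ.1, (hσ.1 _ _ _ _ hc).resolve_left ?_⟩
      rw [hσ.2]; simp
  refine ⟨fun u => decide (μ u false ≤ μ u true), fun u => max (μ u true) (μ u false), ?_⟩
  intro u w a b hc hle
  have h1 := hlt u w a b hc
  have t1 := htot u true
  have t2 := htot w true
  simp only [Bool.not_true] at t1 t2
  simp only at hle
  cases a <;> cases b <;> simp only [Bool.not_true, Bool.not_false] at h1 <;>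
    symm <;> simp <;> omega

/-! ### Fingerprints -/

/-- `W` spans a graph of maximum degree less than `d`. -/
def Sp {n : ℕ} (c : St n) (d : ℕ) (W : Finset (Fin n)) : Prop :=
  ∀ u ∈ W, (W.filter (fun x => c u x ≠ none)).card < d

/-- The Kleitman-Winston algorithm. -/
lemma fingerprint {n : ℕ} (c : St n) (d : ℕ) (hirr : ∀ u, c u u = none) :
    ∀ (m : ℕ) (V : Finset (Fin n)), V.card = m →
    ∃ Ψ : Finset (Fin n) → Finset (Fin n), ∀ N : Finset (Fin n), ∃ T : Finset (Fin n),
      T ⊆ N ∧ T ⊆ V ∧ T.card * d ≤ V.card ∧ Ψ T ⊆ V ∧ Sp c d (Ψ T) ∧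
      ∀ u ∈ N, u ∈ V → u ∈ T ∨ (∃ a ∈ T, c a u ≠ none) ∨ u ∈ Ψ T := by
  intro m
  induction m using Nat.strong_induction_on with
  | _ m ih =>
  intro V hV
  by_cases hsp : Sp c d V
  · refine ⟨fun _ => V, fun N => ⟨∅, by simp, by simp, by simp, by simp, hsp, ?_⟩⟩
    intro u _ hu
    exact Or.inr (Or.inr hu)
  · unfold Sp at hsp
    push Not at hsp
    obtain ⟨a, ha, had⟩ := hsp
    set Na := V.filter (fun x => c a x ≠ none) with hNa
    have haNa : a ∉ Na := by simp [hNa, hirr]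
    have hNaV : Na ⊆ V := filter_subset _ _
    have hc1 : (V.erase a).card < V.card := card_erase_lt_of_mem ha
    have hc2 : ((V.erase a) \ Na).card + Na.card + 1 = V.card := by
      rw [card_sdiff_add_card_eq_card, card_erase_add_one ha]
      intro x hx
      exact mem_erase.2 ⟨fun h => haNa (h ▸ hx), hNaV hx⟩
    obtain ⟨Ψ1, h1⟩ := ih _ (hV ▸ hc1) (V.erase a) rfl
    obtain ⟨Ψ2, h2⟩ := ih ((V.erase a) \ Na).card (by omega) ((V.erase a) \ Na) rfl
    refine ⟨fun T => if a ∈ T then Ψ2 (T.erase a) else Ψ1 T, fun N => ?_⟩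
    by_cases haN : a ∈ N
    · obtain ⟨T, t1, t2, t3, t4, t5, t6⟩ := h2 N
      have haT : a ∉ T := fun h => by simpa using t2 h
      refine ⟨insert a T, ?_, ?_, ?_, ?_, ?_, ?_⟩
      · exact insert_subset haN t1
      · refine insert_subset ha (t2.trans (sdiff_subset.trans (erase_subset _ _)))
      · rw [card_insert_of_notMem haT]
        nlinarith
      · simp only [mem_insert, true_or, if_true, erase_insert haT]
        exact t4.trans (sdiff_subset.trans (erase_subset _ _))
      · simpa only [mem_insert, true_or, if_true, erase_insert haT] using t5
      · intro u huN huV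
        simp only [mem_insert, true_or, if_true, erase_insert haT]
        by_cases hua : u = a
        · exact Or.inl (Or.inl hua)
        by_cases hu2 : u ∈ Na
        · exact Or.inr (Or.inl ⟨a, Or.inl rfl, (mem_filter.1 hu2).2⟩)
        · rcases t6 u huN (mem_sdiff.2 ⟨mem_erase.2 ⟨hua, huV⟩, hu2⟩) with h | ⟨b, hb, h⟩ | h
          · exact Or.inl (Or.inr h)
          · exact Or.inr (Or.inl ⟨b, Or.inr hb, h⟩)
          · exact Or.inr (Or.inr h)
    · obtain ⟨T, t1, t2, t3, t4, t5, t6⟩ := h1 N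
      have haT : a ∉ T := fun h => haN (t1 h)
      refine ⟨T, t1, t2.trans (erase_subset _ _), by omega, ?_, ?_, ?_⟩
      · simp only [haT, if_false]
        exact t4.trans (erase_subset _ _)
      · simpa only [haT, if_false] using t5
      · intro u huN huV
        simp only [haT, if_false]
        exact t6 u huN (mem_erase.2 ⟨fun h => haN (h ▸ huN), huV⟩)

/-! ### Partial rows -/

/-- Support of a row. -/
def sup {n : ℕ} (r : Fin n → O) : Finset (Fin n) := univ.filter (fun u => r u ≠ none)

lemma mem_sup {n : ℕ} {r : Fin n → O} {u} : u ∈ sup r ↔ r u ≠ none := by simp [sup]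

/-- Rows supported on `A` with at most `d` entries. -/
def PP {n : ℕ} (A : Finset (Fin n)) (d : ℕ) : Finset (Fin n → O) :=
  univ.filter (fun r => sup r ⊆ A ∧ (sup r).card ≤ d)

lemma card_PP {n : ℕ} (A : Finset (Fin n)) (d : ℕ) : (PP A d).card ≤ (4 * A.card + 1) ^ d := by
  induction d with
  | zero =>
    simp only [pow_zero]
    rw [card_le_one]
    intro a ha b hb
    simp only [PP, mem_filter, mem_univ, true_and, Nat.le_zero, card_eq_zero] at ha hb
    funext u
    have h1 : u ∉ sup a := by simp [ha.2]
    have h2 : u ∉ sup b := by simp [hb.2]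
    rw [mem_sup, not_not] at h1 h2
    rw [h1, h2]
  | succ d ih =>
    have hsub : PP A (d + 1) ⊆ PP A d ∪ (PP A d ×ˢ (A ×ˢ (univ : Finset (Bool × Bool)))).image
        (fun p => Function.update p.1 p.2.1 (some p.2.2)) := by
      intro r hr
      simp only [PP, mem_filter, mem_univ, true_and] at hr
      rw [mem_union]
      by_cases hd : (sup r).card ≤ d
      · left
        simp [PP, hr.1, hd]
      · right
        have : (sup r).Nonempty := by rw [← card_pos]; omega
        obtain ⟨u, hu⟩ := this
        obtain ⟨x, hx⟩ := Option.ne_none_iff_exists'.1 (mem_sup.1 hu)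
        rw [mem_image]
        refine ⟨(Function.update r u none, u, x), ?_, ?_⟩
        · simp only [mem_product, mem_univ, and_true]
          refine ⟨?_, hr.1 hu⟩
          have hs : sup (Function.update r u none) = (sup r).erase u := by
            ext v
            by_cases hv : v = u
            · subst hv; simp [sup]
            · simp [sup, hv]
          simp only [PP, mem_filter, mem_univ, true_and, hs]
          refine ⟨(erase_subset _ _).trans hr.1, ?_⟩
          rw [card_erase_of_mem hu]; omega
        · simp [hx.symm]
    calc (PP A (d + 1)).card ≤ _ := card_le_card hsub
      _ ≤ _ := card_union_le _ _
      _ ≤ (PP A d).card + (PP A d).card * (A.card * 4) := by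
          gcongr
          refine card_image_le.trans ?_
          simp [card_product]
      _ = (PP A d).card * (4 * A.card + 1) := by ring
      _ ≤ _ := by rw [pow_succ]; gcongr

/-! ### Rows of a structure -/

/-- The rows of `c` at the vertices `e k`. -/
def rows {n K : ℕ} (e : Fin K → Fin n) (c : St n) : Fin n → Fin K → O := fun u k => c (e k) u

lemma Good.none_symm {n : ℕ} {A : Finset (Fin n)} {c : St n} (h : Good A c) {u w}
    (hc : c u w = none) : c w u = none := by
  by_contra hne
  obtain ⟨⟨e, g⟩, h3⟩ := Option.ne_none_iff_exists'.1 hne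
  simp [h.sym _ _ _ _ h3] at hc

lemma rows_inj {n K : ℕ} {A : Finset (Fin n)} (e : Fin K → Fin n) {c1 c2 : St n}
    (h1 : Good A c1) (h2 : Good A c2)
    (hr : restr (univ.image e) c1 = restr (univ.image e) c2) (hrow : rows e c1 = rows e c2) :
    c1 = c2 := by
  have hS : ∀ u ∈ univ.image e, ∀ w, c1 u w = c2 u w := by
    intro u hu w
    obtain ⟨k, -, rfl⟩ := mem_image.1 hu
    exact congrFun (congrFun hrow w) k
  funext u w
  by_cases hu : u ∈ univ.image e
  · exact hS u hu w
  by_cases hw : w ∈ univ.image e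
  · have := hS w hw u
    cases hc : c1 w u with
    | none => rw [h1.none_symm hc, h2.none_symm (this ▸ hc)]
    | some x =>
      rw [h1.sym _ _ _ _ hc, h2.sym _ _ _ _ (this ▸ hc)]
  · have := congrFun (congrFun hr u) w
    simpa only [restr, hu, hw, or_self, if_false] using this

lemma fiber_bound {n K : ℕ} {A : Finset (Fin n)} (e : Fin K → Fin n) (X : Finset (St n))
    (hX : ∀ c ∈ X, Good A c) (B : ℕ)
    (hB : ∀ c', Good (A \ univ.image e) c' →
      ∃ R : Finset (Fin n → Fin K → O), R.card ≤ B ∧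
        ∀ c ∈ X, restr (univ.image e) c = c' → rows e c ∈ R) :
    X.card ≤ B * (CC (A \ univ.image e)).card := by
  refine card_le_mul_card_image_of_maps_to (f := restr (univ.image e))
    (fun c hc => mem_CC.2 ((hX c hc).restr _)) B ?_
  intro c' hc'
  obtain ⟨R, hR, hRm⟩ := hB c' (mem_CC.1 hc')
  refine le_trans ?_ hR
  refine card_le_card_of_injOn (rows e) ?_ ?_
  · intro c hc
    have := mem_filter.1 hc
    exact hRm c this.1 this.2
  · intro c1 hc1 c2 hc2 hrow
    have m1 := mem_filter.1 hc1
    have m2 := mem_filter.1 hc2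
    exact rows_inj e (hX _ m1.1) (hX _ m2.1) (m1.2.trans m2.2.symm) hrow

/-- The options left for the row at a variable dominated by the fingerprint `p`. -/
def L2 {n : ℕ} (c' : St n) (p : Fin n → O) (u : Fin n) : Finset O :=
  univ.filter (fun x => x = none ∨ ∀ a τ α α' β, p a = some (τ, α) → c' a u = some (α', β) →
    x = some (τ, β))

lemma card_L2 {n : ℕ} (c' : St n) (p : Fin n → O) (u : Fin n)
    (h : ∃ a ∈ sup p, c' a u ≠ none) : (L2 c' p u).card ≤ 2 := by
  obtain ⟨a, ha, hc⟩ := h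
  obtain ⟨⟨τ, α⟩, hp⟩ := Option.ne_none_iff_exists'.1 (mem_sup.1 ha)
  obtain ⟨⟨α', β⟩, hc⟩ := Option.ne_none_iff_exists'.1 hc
  refine le_trans (card_le_card (t := {none, some (τ, β)}) ?_) card_le_two
  intro x hx
  simp only [L2, mem_filter, mem_univ, true_and] at hx
  simp only [mem_insert, mem_singleton]
  rcases hx with hx | hx
  · exact Or.inl hx
  · exact Or.inr (hx _ _ _ _ _ hp hc)

lemma mem_L2 {n : ℕ} {A : Finset (Fin n)} {c : St n} (h : Good A c) (S : Finset (Fin n)) (w : Fin n)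
    (p : Fin n → O) (hp : ∀ u, p u ≠ none → p u = c w u) (u : Fin n) :
    c w u ∈ L2 (restr S c) p u := by
  simp only [L2, mem_filter, mem_univ, true_and]
  by_cases hn : c w u = none
  · exact Or.inl hn
  right
  intro a τ α α' β hpa hca
  have hwa : c w a = some (τ, α) := by rw [← hp a (by simp [hpa]), hpa]
  have hau := (restr_some.1 hca).2.2
  obtain ⟨⟨x, y⟩, hwu⟩ := Option.ne_none_iff_exists'.1 hn
  have e1 : x = τ := by
    by_contra hne
    have := h.tri (h.sym _ _ _ _ hwa) hwu (Ne.symm hne)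
    simp [this] at hau
  have e2 : y = β := by
    by_contra hne
    have := h.tri hwu (h.sym _ _ _ _ hau) hne
    simp [this] at hwa
  rw [hwu, e1, e2]


lemma exists_fp {n : ℕ} {A S : Finset (Fin n)} {d : ℕ} (hd : A.card < d * d) {c' : St n}
    (hc' : Good (A \ S) c') :
    ∃ Ψ : Finset (Fin n) → Finset (Fin n), ∀ c, Good A c → restr S c = c' → ∀ w,
      ∃ p ∈ PP A d, (∀ u, p u ≠ none → p u = c w u) ∧ Sp c d (Ψ (sup p)) ∧ Ψ (sup p) ⊆ A \ S ∧
      ∀ u ∈ A \ S, c w u ≠ none → p u ≠ none ∨ (∃ a ∈ sup p, c' a u ≠ none) ∨ u ∈ Ψ (sup p) := by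
  obtain ⟨Ψ, hΨ⟩ := fingerprint c' d hc'.irr _ (A \ S) rfl
  refine ⟨Ψ, fun c hc hcc w => ?_⟩
  obtain ⟨T, t1, t2, t3, t4, t5, t6⟩ := hΨ (sup (c w))
  have hs : sup (fun u => if u ∈ T then c w u else none) = T := by
    ext u
    rw [mem_sup]
    by_cases hu : u ∈ T
    · simpa [hu] using mem_sup.1 (t1 hu)
    · simp [hu]
  refine ⟨fun u => if u ∈ T then c w u else none, ?_, ?_, ?_, ?_, ?_⟩
  · simp only [PP, mem_filter, mem_univ, true_and, hs]
    refine ⟨t2.trans sdiff_subset, ?_⟩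
    have h1 : (A \ S).card ≤ A.card := card_le_card sdiff_subset
    by_contra hlt
    push Not at hlt
    nlinarith
  · intro u hu
    by_cases hT : u ∈ T
    · simp [hT]
    · simp [hT] at hu
  · rw [hs]
    intro u hu
    refine lt_of_le_of_lt (card_le_card ?_) (t5 u hu)
    intro x hx
    rw [mem_filter] at hx ⊢
    refine ⟨hx.1, ?_⟩
    rw [← hcc]
    have h1 := (mem_sdiff.1 (t4 hu)).2
    have h2 := (mem_sdiff.1 (t4 hx.1)).2
    simpa [restr, h1, h2] using hx.2
  · rw [hs]; exact t4
  · intro u hu hne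
    rw [hs]
    rcases t6 u (mem_sup.2 hne) hu with h | h | h
    · left; simpa [h] using hne
    · exact Or.inr (Or.inl h)
    · exact Or.inr (Or.inr h)

/-- The list of options for the entry at `u` of a row with fingerprint `p`. -/
def Lst {n : ℕ} (A S : Finset (Fin n)) (c' : St n) (p : Fin n → O) (P : Finset (Fin n))
    (base : Fin n → Finset O) (u : Fin n) : Finset O :=
  if u ∈ A then (if u ∈ S then univ else if p u = none then
    (if ∃ a ∈ sup p, c' a u ≠ none then L2 c' p u else if u ∈ P then base u else {none})
    else {p u}) else {none}

lemma mem_Lst {n : ℕ} {A S : Finset (Fin n)} {c : St n} (hc : Good A c) {p : Fin n → O}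
    {P : Finset (Fin n)} {base : Fin n → Finset O} {w u : Fin n}
    (hp : ∀ u, p u ≠ none → p u = c w u)
    (hcov : ∀ u ∈ A \ S, c w u ≠ none → p u ≠ none ∨ (∃ a ∈ sup p, restr S c a u ≠ none) ∨ u ∈ P)
    (hbase : u ∈ A → u ∉ S → c w u ∈ base u) : c w u ∈ Lst A S (restr S c) p P base u := by
  unfold Lst
  split_ifs with h1 h2 h3 h4 h5
  · exact mem_univ _
  · exact mem_L2 hc S w p hp u
  · exact hbase h1 h2
  · rw [mem_singleton]
    by_contra hne
    rcases hcov u (mem_sdiff.2 ⟨h1, h2⟩) hne with h | h | h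
    · exact h h3
    · exact h4 h
    · exact h5 h
  · rw [hp u h3]; simp
  · rw [mem_singleton]
    by_contra hne
    obtain ⟨⟨x, y⟩, hwu⟩ := Option.ne_none_iff_exists'.1 hne
    exact h1 (hc.supp2 hwu)

lemma card_Lst_le {n : ℕ} {A S : Finset (Fin n)} {c' : St n} {p : Fin n → O} {P : Finset (Fin n)}
    {base : Fin n → Finset O} {u : Fin n} (hS : u ∉ S) (hP : u ∉ P) :
    (Lst A S c' p P base u).card ≤ 2 := by
  unfold Lst
  rw [if_neg hS, if_neg hP]
  split_ifs with h1 h3 h4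
  · exact card_L2 _ _ _ h4
  · simp
  · simp
  · simp

lemma card_Lst_le_three {n : ℕ} {A S : Finset (Fin n)} {c' : St n} {p : Fin n → O}
    {P : Finset (Fin n)} {base : Fin n → Finset O} {u : Fin n} (hS : u ∉ S)
    (hb : (base u).card ≤ 3) :
    (Lst A S c' p P base u).card ≤ 3 := by
  unfold Lst
  rw [if_neg hS]
  split_ifs with h1 h3 h4
  · exact (card_L2 _ _ _ h4).trans (by norm_num)
  · exact hb
  · simp
  · simp
  · simp

lemma card_Lst_out {n : ℕ} {A S : Finset (Fin n)} {c' : St n} {p : Fin n → O} {P : Finset (Fin n)}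
    {base : Fin n → Finset O} {u : Fin n} (hA : u ∉ A) :
    (Lst A S c' p P base u).card = 1 := by
  unfold Lst
  rw [if_neg hA]; simp

lemma card_O (s : Finset O) : s.card ≤ 5 := by
  refine (card_le_univ s).trans ?_
  simp

lemma prod_ite_card {n : ℕ} {M : Type*} [CommMonoid M] (A : Finset (Fin n)) (x : M) :
    (∏ u : Fin n, if u ∈ A then x else 1) = x ^ A.card := by
  rw [Finset.prod_ite_mem, univ_inter, prod_const]

/-- Admissible triples of entries. -/
def J3 (L : Fin 3 → Finset O) : Finset (Fin 3 → O) :=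
  (Fintype.piFinset L).filter (fun f => (∀ π, f 0 = some (true, π) → f 2 = none) ∧
    (∀ π, f 0 = some (false, π) → f 1 = none))

lemma card_J3_le_prod (L : Fin 3 → Finset O) : (J3 L).card ≤ ∏ k, (L k).card := by
  rw [← Fintype.card_piFinset]
  exact card_le_card (filter_subset _ _)

lemma card_J3 (L : Fin 3 → Finset O) (h : ∀ k, (L k).card ≤ 2) : (J3 L).card ≤ 6 := by
  have hmap : ∀ f ∈ J3 L, f 0 ∈ L 0 := by
    intro f hf
    exact Fintype.mem_piFinset.1 (mem_filter.1 hf).1 0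
  rw [card_eq_sum_card_fiberwise hmap]
  have hfib : ∀ x ∈ L 0, ((J3 L).filter (fun f => f 0 = x)).card ≤ 2 + if x = none then 2 else 0 := by
    intro x hx
    by_cases hxn : x = none
    · rw [if_pos hxn]
      calc _ ≤ (L 1 ×ˢ L 2).card := by
            refine card_le_card_of_injOn (fun f => (f 1, f 2)) ?_ ?_
            · intro f hf
              have hf := mem_filter.1 hf
              have := Fintype.mem_piFinset.1 (mem_filter.1 hf.1).1
              simp [this 1, this 2]
            · intro f hf g hg hfg
              have hf := (mem_filter.1 hf).2
              have hg := (mem_filter.1 hg).2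
              simp only [Prod.mk.injEq] at hfg
              funext k
              fin_cases k
              · exact hf.trans hg.symm
              · exact hfg.1
              · exact hfg.2
        _ = (L 1).card * (L 2).card := card_product _ _
        _ ≤ 2 * 2 := Nat.mul_le_mul (h 1) (h 2)
    · rw [if_neg hxn]
      obtain ⟨⟨b, π⟩, rfl⟩ := Option.ne_none_iff_exists'.1 hxn
      cases b
      · refine le_trans (card_le_card_of_injOn (t := L 2) (fun f => f 2) ?_ ?_) (h 2)
        · intro f hf
          have hf := mem_filter.1 hf
          exact Fintype.mem_piFinset.1 (mem_filter.1 hf.1).1 2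
        · intro f hf g hg hfg
          have hf := (mem_filter.1 hf)
          have hg := (mem_filter.1 hg)
          have hf1 := (mem_filter.1 hf.1).2.2 π hf.2
          have hg1 := (mem_filter.1 hg.1).2.2 π hg.2
          funext k
          fin_cases k
          · exact hf.2.trans hg.2.symm
          · exact hf1.trans hg1.symm
          · exact hfg
      · refine le_trans (card_le_card_of_injOn (t := L 1) (fun f => f 1) ?_ ?_) (h 1)
        · intro f hf
          have hf := mem_filter.1 hf
          exact Fintype.mem_piFinset.1 (mem_filter.1 hf.1).1 1
        · intro f hf g hg hfg
          have hf := (mem_filter.1 hf)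
          have hg := (mem_filter.1 hg)
          have hf1 := (mem_filter.1 hf.1).2.1 π hf.2
          have hg1 := (mem_filter.1 hg.1).2.1 π hg.2
          funext k
          fin_cases k
          · exact hf.2.trans hg.2.symm
          · exact hfg
          · exact hf1.trans hg1.symm
  refine (sum_le_sum hfib).trans ?_
  rw [sum_add_distrib, sum_const, sum_ite_eq' (L 0) none (fun _ => 2)]
  have := h 0
  split_ifs <;> simp <;> omega

/-- Structures without large sparse sets, not unate at the vertex `e 0`. -/
def TT {n : ℕ} (A : Finset (Fin n)) (d : ℕ) (e : Fin 3 → Fin n) : Finset (St n) :=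
  (CC A).filter (fun c => (∃ x, c (e 0) (e 1) = some (true, x)) ∧
    (∃ y, c (e 0) (e 2) = some (false, y)) ∧ ∀ W ⊆ A, Sp c d W → 100 * W.card < A.card)

lemma card_TT {n : ℕ} (A : Finset (Fin n)) (d : ℕ) (hd : A.card < d * d) (e : Fin 3 → Fin n) :
    (TT A d e).card ≤ (((4 * A.card + 1) ^ d) ^ 3 * (6 ^ A.card * 125 ^ (3 + 3 * A.card / 100))) *
      (CC (A \ univ.image e)).card := by
  refine fiber_bound e _ (fun c hc => mem_CC.1 (mem_filter.1 hc).1) _ ?_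
  intro c' hc'
  obtain ⟨Ψ, hΨ⟩ := exists_fp hd hc'
  set S := univ.image e with hS
  let Jp : (Fin 3 → Fin n → O) → Fin n → Finset (Fin 3 → O) := fun p u =>
    J3 (fun k => Lst A S c' (p k) (Ψ (sup (p k))) (fun _ => univ) u)
  let D : Finset (Fin 3 → Fin n → O) := Fintype.piFinset (fun _ => PP A d)
  let F : (Fin 3 → Fin n → O) → Finset (Fin n → Fin 3 → O) := fun p =>
    if ∀ k, 100 * (Ψ (sup (p k))).card < A.card then Fintype.piFinset (Jp p) else ∅
  refine ⟨D.biUnion F, ?_, ?_⟩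
  · refine (card_biUnion_le_card_mul D F (6 ^ A.card * 125 ^ (3 + 3 * A.card / 100)) ?_).trans ?_
    · intro p _
      simp only [F]
      split_ifs with hval
      swap
      · simp
      rw [Fintype.card_piFinset]
      calc ∏ u, (Jp p u).card
          ≤ ∏ u, ((if u ∈ A then 6 else 1) * (if u ∈ S then 125 else 1) *
              ∏ k, if u ∈ Ψ (sup (p k)) then 125 else 1) := by
            refine prod_le_prod' fun u _ => ?_
            have one_le : ∀ (Q : Finset (Fin n)), 1 ≤ (if u ∈ Q then 125 else 1) := by
              intro Q; split_ifs <;> norm_num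
            have one_le' : 1 ≤ ∏ k, (if u ∈ Ψ (sup (p k)) then 125 else 1) :=
              one_le_prod' fun k _ => one_le _
            by_cases hA : u ∈ A
            · have h125 : (Jp p u).card ≤ 125 := by
                refine (card_J3_le_prod _).trans ?_
                calc _ ≤ ∏ k : Fin 3, 5 := prod_le_prod' fun k _ => card_O _
                  _ = 125 := by simp
              rw [if_pos hA]
              by_cases huS : u ∈ S
              · rw [if_pos huS]
                nlinarith
              by_cases huP : ∃ k, u ∈ Ψ (sup (p k))
              · obtain ⟨k, hk⟩ := huP
                have : 125 ≤ ∏ k, (if u ∈ Ψ (sup (p k)) then 125 else 1) := by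
                  refine le_trans (by rw [if_pos hk]) (single_le_prod' (f := fun k =>
                    (if u ∈ Ψ (sup (p k)) then 125 else 1)) (fun k _ => one_le _) (mem_univ k))
                have := one_le S
                nlinarith
              · push Not at huP
                have h6 : (Jp p u).card ≤ 6 := card_J3 _ fun k => card_Lst_le huS (huP k)
                have := one_le S
                nlinarith
            · have : (Jp p u).card ≤ 1 := by
                refine (card_J3_le_prod _).trans ?_
                simp only [card_Lst_out hA]
                simp
              rw [if_neg hA]
              have := one_le S
              nlinarith
        _ = 6 ^ A.card * 125 ^ S.card * ∏ k, 125 ^ (Ψ (sup (p k))).card := by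
            rw [prod_mul_distrib, prod_mul_distrib, prod_ite_card, prod_ite_card, Finset.prod_comm]
            congr 1
            exact prod_congr rfl fun k _ => prod_ite_card _ _
        _ ≤ _ := by
            rw [prod_pow_eq_pow_sum, mul_assoc, ← pow_add]
            refine Nat.mul_le_mul_left _ (Nat.pow_le_pow_right (by norm_num) ?_)
            have h1 : S.card ≤ 3 := card_image_le.trans (by simp)
            rw [Fin.sum_univ_three]
            have := hval 0
            have := hval 1
            have := hval 2
            omega
    · refine Nat.mul_le_mul_right _ ?_
      simp only [D, Fintype.card_piFinset, prod_const, card_univ, Fintype.card_fin]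
      exact Nat.pow_le_pow_left (card_PP A d) 3
  · intro c hc hcc
    obtain ⟨hcA, ⟨x, hx⟩, ⟨y, hy⟩, hsp⟩ := mem_filter.1 hc
    have hg := mem_CC.1 hcA
    choose p hp1 hp2 hp3 hp4 hp5 using fun k => hΨ c hg hcc (e k)
    rw [mem_biUnion]
    refine ⟨p, Fintype.mem_piFinset.2 hp1, ?_⟩
    simp only [F]
    rw [if_pos (fun k => hsp _ ((hp4 k).trans sdiff_subset) (hp3 k)), Fintype.mem_piFinset]
    intro u
    simp only [Jp, J3, mem_filter, Fintype.mem_piFinset, rows]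
    refine ⟨fun k => ?_, ?_, ?_⟩
    · have := hp5 k
      rw [← hcc] at this ⊢
      exact mem_Lst hg (hp2 k) this (fun _ _ => mem_univ _)
    · intro π hπ
      exact hg.tri (hg.sym _ _ _ _ hy) hπ (by simp)
    · intro π hπ
      exact hg.tri (hg.sym _ _ _ _ hx) hπ (by simp)


/-! ### Structures with a large sparse set -/

/-- Structures with a largest sparse set which is large and contains all `e k`. -/
def SS {n K : ℕ} (A : Finset (Fin n)) (d : ℕ) (e : Fin K → Fin n) : Finset (St n) :=
  (CC A).filter (fun c => ∃ W ⊆ A, univ.image e ⊆ W ∧ Sp c d W ∧ A.card ≤ 100 * W.card ∧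
    ∀ W' ⊆ A, Sp c d W' → W'.card ≤ W.card)

/-- Options for an entry, given ordering information. -/
def bs {n K : ℕ} (I : Fin n → Bool × Fin (K + 1)) (w u : Fin n) : Finset O :=
  if (I w).2 < (I u).2 then {none, some (true, (I u).1), some (false, (I u).1)}
  else {none, some ((I w).1, true), some ((I w).1, false)}

lemma card_bs {n K : ℕ} (I : Fin n → Bool × Fin (K + 1)) (w u : Fin n) : (bs I w u).card ≤ 3 := by
  unfold bs
  split_ifs <;> exact card_le_three

lemma exists_info {n K : ℕ} {A : Finset (Fin n)} (e : Fin K → Fin n) {c : St n} (hc : Good A c) :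
    ∃ I : Fin n → Bool × Fin (K + 1), (∀ u, u ∉ A → I u = (false, 0)) ∧
      ∀ k, e k ∈ A → ∀ u ∈ A, c (e k) u ∈ bs I (e k) u := by
  obtain ⟨s, κ, h⟩ := hc.ord
  set S := univ.image e with hS
  have hSK : S.card ≤ K := card_image_le.trans (by simp)
  let pos : Fin n → Finset (Fin n) := fun z => S.filter (fun w => κ w < κ z)
  have hpos : ∀ z, (pos z).card < K + 1 := fun z =>
    Nat.lt_succ_of_le ((card_le_card (filter_subset _ _)).trans hSK)
  refine ⟨fun u => if u ∈ A then (s u, ⟨(pos u).card, hpos u⟩) else (false, 0), ?_, ?_⟩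
  · intro u hu
    simp [hu]
  intro k hk u hu
  unfold bs
  simp only [hk, hu, if_true]
  cases hcu : c (e k) u with
  | none => split_ifs <;> simp
  | some x =>
  obtain ⟨a, b⟩ := x
  have mono : ∀ x y, κ x ≤ κ y → (pos x).card ≤ (pos y).card := by
    intro x y hxy
    refine card_le_card ?_
    intro z hz
    rw [mem_filter] at hz ⊢
    exact ⟨hz.1, lt_of_lt_of_le hz.2 hxy⟩
  have strict : κ (e k) < κ u → (pos (e k)).card < (pos u).card := by
    intro hlt
    refine card_lt_card ?_
    rw [ssubset_iff_of_subset]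
    · refine ⟨e k, mem_filter.2 ⟨mem_image_of_mem _ (mem_univ _), hlt⟩, ?_⟩
      simp [pos]
    · intro z hz
      rw [mem_filter] at hz ⊢
      exact ⟨hz.1, lt_trans hz.2 hlt⟩
  split_ifs with hlt
  · have hlt' : (pos (e k)).card < (pos u).card := hlt
    have h1 : κ (e k) ≤ κ u := by
      by_contra hcon
      have := mono u (e k) (not_le.1 hcon).le
      omega
    rw [h _ _ _ _ hcu h1]
    cases a <;> simp
  · have hlt' : ¬ (pos (e k)).card < (pos u).card := hlt
    have h1 : κ u ≤ κ (e k) := by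
      by_contra hcon
      exact hlt' (strict (not_le.1 hcon))
    rw [h _ _ _ _ (hc.sym _ _ _ _ hcu) h1]
    cases b <;> simp

set_option maxHeartbeats 1000000 in
lemma card_SS {n k K : ℕ} (hK : K = 100 * k) (A : Finset (Fin n)) (d : ℕ) (hd : A.card < d * d)
    (e : Fin K → Fin n) :
    ((SS A d e).card : ℝ) ≤ (((2 ^ A.card * (2 * (K + 1)) ^ A.card *
      ((((4 * A.card + 1) ^ d) ^ K) * (((4 * A.card + 1) ^ d) ^ K)) : ℕ) : ℝ) *
      ((2 ^ A.card * 5 ^ K) ^ K * (3 / 4) ^ (k * A.card))) *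
      (CC (A \ univ.image e)).card := by
  set Y : ℝ := (2 ^ A.card * 5 ^ K) ^ K * (3 / 4) ^ (k * A.card) with hY
  set Dn : ℕ := 2 ^ A.card * (2 * (K + 1)) ^ A.card *
      ((((4 * A.card + 1) ^ d) ^ K) * (((4 * A.card + 1) ^ d) ^ K)) with hDn
  have hY0 : 0 ≤ Y := by positivity
  have key : (SS A d e).card ≤ ⌊(Dn : ℝ) * Y⌋₊ * (CC (A \ univ.image e)).card := by
    refine fiber_bound e _ (fun c hc => mem_CC.1 (mem_filter.1 hc).1) _ ?_
    intro c' hc'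
    obtain ⟨Ψ, hΨ⟩ := exists_fp hd hc'
    set S := univ.image e with hS
    have hSK : S.card ≤ K := card_image_le.trans (by simp)
    let IS : Finset (Fin n → Bool × Fin (K + 1)) :=
      Fintype.piFinset (fun u => if u ∈ A then univ else {(false, 0)})
    have hIS : IS.card = (2 * (K + 1)) ^ A.card := by
      simp only [IS, Fintype.card_piFinset]
      rw [← prod_ite_card]
      refine prod_congr rfl fun u _ => ?_
      split_ifs <;> simp
    let PK : Finset (Fin K → Fin n → O) := Fintype.piFinset (fun _ => PP A d)
    have hPK : PK.card ≤ ((4 * A.card + 1) ^ d) ^ K := by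
      simp only [PK, Fintype.card_piFinset, prod_const, card_univ, Fintype.card_fin]
      exact Nat.pow_le_pow_left (card_PP A d) K
    let D := (A.powerset ×ˢ IS) ×ˢ (PK ×ˢ PK)
    have hD : D.card ≤ Dn := by
      simp only [D, card_product, card_powerset, hIS, hDn]
      gcongr
    let L : ((Finset (Fin n) × (Fin n → Bool × Fin (K + 1))) ×
        ((Fin K → Fin n → O) × (Fin K → Fin n → O))) → Fin n → Fin K → Finset O := fun D u k =>
      if u ∈ D.1.1 \ S then {D.2.2 k u} else
        Lst A S c' (D.2.1 k) (Ψ (sup (D.2.1 k))) (bs D.1.2 (e k)) u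
    let F : ((Finset (Fin n) × (Fin n → Bool × Fin (K + 1))) ×
        ((Fin K → Fin n → O) × (Fin K → Fin n → O))) → Finset (Fin n → Fin K → O) := fun D =>
      if S ⊆ D.1.1 ∧ A.card ≤ 100 * D.1.1.card ∧ ∀ k, (Ψ (sup (D.2.1 k))).card ≤ D.1.1.card then
        Fintype.piFinset (fun u => Fintype.piFinset (fun k => L D u k)) else ∅
    have hF : ∀ x ∈ D, ((F x).card : ℝ) ≤ Y := by
      rintro ⟨⟨W, I⟩, p1, p2⟩ hx
      have hWA : W ⊆ A := by
        simp only [D, mem_product, mem_powerset] at hx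
        exact hx.1.1
      simp only [F]
      split_ifs with hval
      swap
      · simpa using hY0
      obtain ⟨hSW, hAW, hΨW⟩ := hval
      simp only [Fintype.card_piFinset]
      rw [Finset.prod_comm]
      push_cast
      have hrow : ∀ k, (∏ u, ((L ((W, I), p1, p2) u k).card : ℝ)) ≤
          (2 ^ A.card * 5 ^ K) * (3 / 4) ^ W.card := by
        intro k
        calc (∏ u, ((L ((W, I), p1, p2) u k).card : ℝ))
            ≤ ∏ u, ((if u ∈ A then (2 : ℝ) else 1) * (if u ∈ S then (5 : ℝ) else 1) *
              (if u ∈ W then (1 / 2 : ℝ) else 1) *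
              (if u ∈ Ψ (sup (p1 k)) then (3 / 2 : ℝ) else 1)) := by
              refine prod_le_prod (fun u _ => by positivity) fun u _ => ?_
              have h1 : (1 : ℝ) ≤ (if u ∈ Ψ (sup (p1 k)) then (3 / 2 : ℝ) else 1) := by
                split_ifs <;> norm_num
              simp only [L]
              by_cases huA : u ∈ A
              · rw [if_pos huA]
                by_cases huS : u ∈ S
                · have huW := hSW huS
                  rw [if_pos huS, if_pos huW]
                  have : ((if u ∈ W \ S then {p2 k u} else
                    Lst A S c' (p1 k) (Ψ (sup (p1 k))) (bs I (e k)) u : Finset O).card : ℝ) ≤ 5 := by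
                    exact_mod_cast card_O _
                  linarith
                · rw [if_neg huS]
                  by_cases huW : u ∈ W
                  · rw [if_pos huW, if_pos (mem_sdiff.2 ⟨huW, huS⟩), card_singleton]
                    push_cast
                    linarith
                  · rw [if_neg huW, if_neg (fun h => huW (Finset.mem_sdiff.1 h).1)]
                    by_cases huP : u ∈ Ψ (sup (p1 k))
                    · rw [if_pos huP]
                      have : ((Lst A S c' (p1 k) (Ψ (sup (p1 k))) (bs I (e k)) u).card : ℝ) ≤ 3 := by
                        exact_mod_cast card_Lst_le_three huS (card_bs _ _ _)
                      linarith
                    · rw [if_neg huP]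
                      have : ((Lst A S c' (p1 k) (Ψ (sup (p1 k))) (bs I (e k)) u).card : ℝ) ≤ 2 := by
                        exact_mod_cast card_Lst_le huS huP
                      linarith
              · have huW : u ∉ W := fun h => huA (hWA h)
                have huS : u ∉ S := fun h => huW (hSW h)
                rw [if_neg huA, if_neg huS, if_neg huW, if_neg (fun h => huW (Finset.mem_sdiff.1 h).1),
                  card_Lst_out huA]
                push_cast
                linarith
          _ = 2 ^ A.card * 5 ^ S.card * (1 / 2) ^ W.card * (3 / 2) ^ (Ψ (sup (p1 k))).card := by
              simp only [prod_mul_distrib, prod_ite_card]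
          _ ≤ 2 ^ A.card * 5 ^ K * (1 / 2) ^ W.card * (3 / 2) ^ W.card := by
              have e1 : (5 : ℝ) ^ S.card ≤ 5 ^ K := pow_le_pow_right₀ (by norm_num) hSK
              have e2 : (3 / 2 : ℝ) ^ (Ψ (sup (p1 k))).card ≤ (3 / 2) ^ W.card :=
                pow_le_pow_right₀ (by norm_num) (hΨW k)
              have e3 : (2 : ℝ) ^ A.card * 5 ^ S.card * (1 / 2) ^ W.card ≤
                  2 ^ A.card * 5 ^ K * (1 / 2) ^ W.card :=
                mul_le_mul_of_nonneg_right (mul_le_mul_of_nonneg_left e1 (by positivity))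
                  (by positivity)
              exact mul_le_mul e3 e2 (by positivity) (by positivity)
          _ = _ := by
              rw [mul_assoc (2 ^ A.card * 5 ^ K), ← mul_pow]
              norm_num
      calc _ ≤ ∏ _k : Fin K, ((2 ^ A.card * 5 ^ K) * (3 / 4) ^ W.card : ℝ) :=
            prod_le_prod (fun k _ => prod_nonneg fun u _ => by positivity) fun k _ => hrow k
        _ = (2 ^ A.card * 5 ^ K) ^ K * (3 / 4) ^ (W.card * K) := by
            rw [prod_const, card_univ, Fintype.card_fin, mul_pow, ← pow_mul]
        _ ≤ Y := by
            rw [hY]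
            refine mul_le_mul_of_nonneg_left ?_ (by positivity)
            refine pow_le_pow_of_le_one (by norm_num) (by norm_num) ?_
            rw [hK]
            nlinarith
    refine ⟨D.biUnion F, ?_, ?_⟩
    · refine Nat.le_floor ?_
      calc ((D.biUnion F).card : ℝ) ≤ ∑ x ∈ D, ((F x).card : ℝ) := by
            exact_mod_cast card_biUnion_le
        _ ≤ ∑ x ∈ D, Y := sum_le_sum hF
        _ = D.card * Y := by rw [sum_const, nsmul_eq_mul]
        _ ≤ Dn * Y := by gcongr
    · intro c hc hcc
      obtain ⟨hcA, W, hWA, hSW, hsp, hAW, hmax⟩ := mem_filter.1 hc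
      have hg := mem_CC.1 hcA
      choose p hp1 hp2 hp3 hp4 hp5 using fun k => hΨ c hg hcc (e k)
      obtain ⟨I, hI1, hI2⟩ := exists_info e hg
      rw [mem_biUnion]
      have hek : ∀ k, e k ∈ W := fun k => hSW (mem_image_of_mem _ (mem_univ _))
      refine ⟨((W, I), p, fun k u => if u ∈ W then c (e k) u else none), ?_, ?_⟩
      · simp only [D, mem_product, mem_powerset]
        refine ⟨⟨hWA, ?_⟩, Fintype.mem_piFinset.2 hp1, ?_⟩
        · simp only [IS, Fintype.mem_piFinset]
          intro u
          split_ifs with hu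
          · exact mem_univ _
          · rw [mem_singleton]; exact hI1 u hu
        · simp only [PK, Fintype.mem_piFinset]
          intro k
          have hs : sup (fun u => if u ∈ W then c (e k) u else none) =
              W.filter (fun x => c (e k) x ≠ none) := by
            ext u
            rw [mem_sup, mem_filter]
            by_cases hu : u ∈ W <;> simp [hu]
          simp only [PP, mem_filter, mem_univ, true_and, hs]
          exact ⟨(filter_subset _ _).trans hWA, (hsp _ (hek k)).le⟩
      · simp only [F]
        rw [if_pos ⟨hSW, hAW, fun k => hmax _ ((hp4 k).trans sdiff_subset) (hp3 k)⟩]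
        simp only [Fintype.mem_piFinset, L, rows]
        intro u k
        split_ifs with hu h2
        · simp
        · exact absurd (mem_sdiff.1 hu).1 h2
        · have := hp5 k
          rw [← hcc] at this ⊢
          exact mem_Lst hg (hp2 k) this (fun hA _ => hI2 k (hWA (hek k)) u hA)
  calc ((SS A d e).card : ℝ) ≤ (⌊(Dn : ℝ) * Y⌋₊ : ℝ) * (CC (A \ univ.image e)).card := by
        exact_mod_cast key
    _ ≤ _ := mul_le_mul_of_nonneg_right (Nat.floor_le (mul_nonneg (Nat.cast_nonneg _) hY0))
        (Nat.cast_nonneg _)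

/-! ### Unate structures -/

/-- The structure described by a graph with loops. -/
def dec {n : ℕ} (E : Finset (Sym2 (Fin n))) : St n := fun u w =>
  if u ≠ w ∧ s(u, w) ∈ E then some (decide (s(u, u) ∈ E), decide (s(w, w) ∈ E)) else none

/-- Unate structures. -/
def UU {n : ℕ} (A : Finset (Fin n)) : Finset (St n) :=
  (CC A).filter (fun c => ∃ s : Fin n → Bool, ∀ u w a b, c u w = some (a, b) → a = s u)

/-- Exponent in the count. -/
def T (m : ℕ) : ℕ := m * (m + 1) / 2

lemma card_sym2_T {n : ℕ} (A : Finset (Fin n)) : A.sym2.card = T A.card := by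
  rw [card_sym2, Nat.choose_two_right, T]
  simp [mul_comm]

lemma card_UU {n : ℕ} (A : Finset (Fin n)) : (UU A).card ≤ 2 ^ T A.card := by
  have hsub : UU A ⊆ A.sym2.powerset.image dec := by
    intro c hc
    obtain ⟨hcA, s, hs⟩ := mem_filter.1 hc
    have hg := mem_CC.1 hcA
    rw [mem_image]
    refine ⟨A.sym2.filter (fun z => ∃ i j, z = s(i, j) ∧ (c i j ≠ none ∨ (i = j ∧ s i = true))),
      by simp, ?_⟩
    have hdiag : ∀ u ∈ A, (decide (s(u, u) ∈ A.sym2.filter (fun z => ∃ i j, z = s(i, j) ∧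
        (c i j ≠ none ∨ (i = j ∧ s i = true))))) = s u := by
      intro u hu
      cases hsu : s u
      · rw [decide_eq_false_iff_not]
        intro hmem
        obtain ⟨-, i, j, hij, h⟩ := mem_filter.1 hmem
        have h' : i = u ∧ j = u := by
          rw [Sym2.eq_iff] at hij
          rcases hij with h | h <;> exact ⟨by tauto, by tauto⟩
        obtain ⟨rfl, rfl⟩ := h'
        simp [hg.irr, hsu] at h
      · rw [decide_eq_true_iff, mem_filter]
        exact ⟨by simp [hu], u, u, rfl, Or.inr ⟨rfl, hsu⟩⟩
    funext u w
    unfold dec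
    cases hc : c u w with
    | none =>
      rw [if_neg]
      rintro ⟨hne, hmem⟩
      obtain ⟨-, i, j, hij, h⟩ := mem_filter.1 hmem
      rw [Sym2.eq_iff] at hij
      have hc2 := hg.none_symm hc
      rcases hij with ⟨rfl, rfl⟩ | ⟨rfl, rfl⟩
      · rcases h with h | h
        · exact h hc
        · exact hne h.1
      · rcases h with h | h
        · exact h hc2
        · exact hne h.1.symm
    | some x =>
      obtain ⟨a, b⟩ := x
      have hu := hg.supp _ _ _ _ hc
      have hw := hg.supp2 hc
      rw [if_pos, hdiag u hu, hdiag w hw, hs _ _ _ _ hc, hs _ _ _ _ (hg.sym _ _ _ _ hc)]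
      refine ⟨hg.ne hc, mem_filter.2 ⟨by simp [hu, hw], u, w, rfl, Or.inl (by simp [hc])⟩⟩
  calc (UU A).card ≤ _ := card_le_card hsub
    _ ≤ _ := card_image_le
    _ = _ := by rw [card_powerset, card_sym2_T]

/-! ### The recursion for structures -/

/-- Injective sequences in `A`. -/
def IJ {n : ℕ} (A : Finset (Fin n)) (K : ℕ) : Finset (Fin K → Fin n) :=
  univ.filter (fun e => Function.Injective e ∧ ∀ k, e k ∈ A)

lemma card_IJ {n : ℕ} (A : Finset (Fin n)) (K : ℕ) : (IJ A K).card ≤ A.card ^ K := by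
  calc (IJ A K).card ≤ (Fintype.piFinset (fun _ : Fin K => A)).card := by
        refine card_le_card fun e he => ?_
        rw [Fintype.mem_piFinset]
        exact (mem_filter.1 he).2.2
    _ = _ := by simp

lemma card_IJ_sdiff {n : ℕ} {A : Finset (Fin n)} {K : ℕ} {e : Fin K → Fin n} (he : e ∈ IJ A K) :
    (A \ univ.image e).card + K = A.card := by
  have h := (mem_filter.1 he).2
  have h1 : (univ.image e).card = K := by
    rw [card_image_of_injective _ h.1]; simp
  have h2 : univ.image e ⊆ A := by
    intro x hx
    obtain ⟨k, -, rfl⟩ := mem_image.1 hx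
    exact h.2 k
  have := card_sdiff_add_card_eq_card h2
  omega

lemma cover {n : ℕ} (A : Finset (Fin n)) (d K : ℕ) (hm : 100 * K ≤ A.card) :
    CC A ⊆ UU A ∪ ((IJ A 3).biUnion (TT A d) ∪ (IJ A K).biUnion (SS A d)) := by
  intro c hc
  have hg := mem_CC.1 hc
  have hex : ∃ W ∈ A.powerset.filter (Sp c d), ∀ W' ∈ A.powerset.filter (Sp c d),
      W'.card ≤ W.card := by
    refine exists_max_image _ _ ⟨∅, ?_⟩
    simp [Sp]
  obtain ⟨W, hW, hmax⟩ := hex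
  rw [mem_filter, mem_powerset] at hW
  have hmax' : ∀ W' ⊆ A, Sp c d W' → W'.card ≤ W.card := fun W' h1 h2 =>
    hmax W' (mem_filter.2 ⟨mem_powerset.2 h1, h2⟩)
  rw [mem_union, mem_union]
  by_cases hbig : A.card ≤ 100 * W.card
  · right; right
    have hKW : K ≤ W.card := by omega
    obtain ⟨S, hSW, hSc⟩ := exists_subset_card_eq hKW
    let e : Fin K → Fin n := fun k => (S.equivFinOfCardEq hSc).symm k
    have heS : ∀ k, e k ∈ S := fun k => ((S.equivFinOfCardEq hSc).symm k).2
    rw [mem_biUnion]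
    refine ⟨e, mem_filter.2 ⟨mem_univ _, ?_, fun k => hW.1 (hSW (heS k))⟩, ?_⟩
    · intro x y hxy
      exact (S.equivFinOfCardEq hSc).symm.injective (Subtype.ext hxy)
    · refine mem_filter.2 ⟨hc, W, hW.1, ?_, hW.2, hbig, hmax'⟩
      intro x hx
      obtain ⟨k, -, rfl⟩ := mem_image.1 hx
      exact hSW (heS k)
  push Not at hbig
  by_cases hun : ∀ u, ∃ s : Bool, ∀ w a b, c u w = some (a, b) → a = s
  · left
    choose s hs using hun
    exact mem_filter.2 ⟨hc, s, hs⟩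
  · right; left
    push Not at hun
    obtain ⟨u, hu⟩ := hun
    obtain ⟨w, a, b, h1, ha⟩ := hu false
    obtain ⟨w', a', b', h2, ha'⟩ := hu true
    have ha : a = true := by simpa using ha
    have ha' : a' = false := by simpa using ha'
    subst ha ha'
    have hww : w ≠ w' := by
      rintro rfl
      simp [h1] at h2
    rw [mem_biUnion]
    refine ⟨![u, w, w'], mem_filter.2 ⟨mem_univ _, ?_, ?_⟩, mem_filter.2 ⟨hc, ⟨b, h1⟩, ⟨b', h2⟩, ?_⟩⟩
    · have := hg.ne h1
      have := hg.ne h2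
      intro x y hxy
      fin_cases x <;> fin_cases y <;> simp_all
    · have := hg.supp _ _ _ _ h1
      have := hg.supp2 h1
      have := hg.supp2 h2
      intro k
      fin_cases k <;> simp_all
    · intro W' h1 h2
      exact lt_of_le_of_lt (Nat.mul_le_mul_left _ (hmax' W' h1 h2)) hbig

lemma T_add (a K : ℕ) : T (a + K) = T a + K * a + T K := by
  unfold T
  have h : ∀ x, x * (x + 1) / 2 * 2 = x * (x + 1) := fun x =>
    Nat.div_mul_cancel (Nat.even_mul_succ_self x).two_dvd
  have h1 := h (a + K)
  have h2 := h a
  have h3 := h K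
  nlinarith

lemma two_pow_T (m a K : ℕ) (h : a + K = m) :
    (2 : ℝ) ^ T a * (2 ^ m) ^ K ≤ 2 ^ (K * K) * 2 ^ T m := by
  rw [← h, ← pow_mul, ← pow_add, ← pow_add, T_add]
  refine pow_le_pow_right₀ (by norm_num) ?_
  nlinarith

lemma card_CC_triv {n : ℕ} (A : Finset (Fin n)) : (CC A).card ≤ (5 ^ A.card) ^ A.card := by
  have hsub : CC A ⊆ Fintype.piFinset (fun u => Fintype.piFinset (fun w =>
      if u ∈ A then (if w ∈ A then univ else {none}) else {none})) := by
    intro c hc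
    have hg := mem_CC.1 hc
    simp only [Fintype.mem_piFinset]
    intro u w
    cases hcu : c u w with
    | none => split_ifs <;> simp
    | some x =>
      have h1 := hg.supp _ _ _ _ hcu
      have h2 := hg.supp2 hcu
      simp [h1, h2]
  refine (card_le_card hsub).trans (le_of_eq ?_)
  simp only [Fintype.card_piFinset]
  rw [← prod_ite_card A (5 ^ A.card)]
  refine prod_congr rfl fun u _ => ?_
  split_ifs with hu
  · rw [← prod_ite_card A 5]
    refine prod_congr rfl fun w _ => ?_
    split_ifs <;> simp
  · simp

/-! ### Asymptotics -/

lemma subexp_lim (C : ℕ) (q : ℝ) (hq0 : 0 ≤ q) (hq1 : q < 1) :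
    Tendsto (fun m : ℕ => (4 * (m : ℝ) + 1) ^ (C * (Nat.sqrt m + 2)) * q ^ m) atTop (nhds 0) := by
  let f : ℕ → ℝ := fun s => (4 * (s : ℝ)) ^ (6 * C) * q ^ s
  have hf : Tendsto f atTop (nhds 0) := by
    have h := (tendsto_pow_const_mul_const_pow_of_abs_lt_one (6 * C)
      (by rw [abs_of_nonneg hq0]; exact hq1 : |q| < 1)).const_mul ((4 : ℝ) ^ (6 * C))
    rw [mul_zero] at h
    refine h.congr fun s => ?_
    simp only [f]
    rw [mul_pow, mul_assoc]
  have hsq : Tendsto Nat.sqrt atTop atTop := by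
    refine tendsto_atTop.2 fun b => ?_
    filter_upwards [eventually_ge_atTop (b * b)] with m hm
    exact Nat.le_sqrt.2 hm
  have hfs := hf.comp hsq
  refine squeeze_zero' (Eventually.of_forall fun m => by positivity) ?_ hfs
  have hev : ∀ᶠ m : ℕ in atTop, f (Nat.sqrt m) ≤ 1 :=
    (hfs.eventually (gt_mem_nhds (zero_lt_one))).mono fun m hm => le_of_lt hm
  filter_upwards [hev, hsq.eventually_ge_atTop 1] with m h1 h2
  set s := Nat.sqrt m with hs
  have hm1 : s * s ≤ m := Nat.sqrt_le m
  have hm2 : m < (s + 1) * (s + 1) := Nat.lt_succ_sqrt m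
  have hs1 : (1 : ℝ) ≤ s := by exact_mod_cast h2
  have hb : 4 * (m : ℝ) + 1 ≤ (4 * (s : ℝ)) ^ 2 := by
    have : (m : ℝ) + 1 ≤ (s + 1) * (s + 1) := by exact_mod_cast hm2
    nlinarith
  have hb1 : (1 : ℝ) ≤ 4 * s := by linarith
  calc (4 * (m : ℝ) + 1) ^ (C * (s + 2)) * q ^ m
      ≤ ((4 * (s : ℝ)) ^ 2) ^ (C * (s + 2)) * q ^ (s * s) := by
        refine mul_le_mul (pow_le_pow_left₀ (by positivity) hb _)
          (pow_le_pow_of_le_one hq0 hq1.le hm1) (by positivity) (by positivity)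
    _ ≤ (4 * (s : ℝ)) ^ (6 * C * s) * q ^ (s * s) := by
        refine mul_le_mul_of_nonneg_right ?_ (by positivity)
        rw [← pow_mul]
        refine pow_le_pow_right₀ hb1 ?_
        nlinarith
    _ = f s ^ s := by
        simp only [f]
        rw [mul_pow _ (q ^ s) s, ← pow_mul, ← pow_mul]
    _ ≤ f s ^ 1 := pow_le_pow_of_le_one (by positivity) h1 h2
    _ = f s := pow_one _

/-- Number of ways to extend in the triple case. -/
def X3 (m : ℕ) : ℝ :=
  ((4 * (m : ℝ) + 1) ^ (Nat.sqrt m + 1)) ^ 3 * (6 ^ m * 125 ^ (3 + 3 * m / 100))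

/-- Number of ways to extend in the sparse case. -/
def XK (k K m : ℕ) : ℝ :=
  (2 ^ m * (2 * ((K : ℝ) + 1)) ^ m * (((4 * (m : ℝ) + 1) ^ (Nat.sqrt m + 1)) ^ K *
    ((4 * (m : ℝ) + 1) ^ (Nat.sqrt m + 1)) ^ K)) * ((2 ^ m * 5 ^ K) ^ K * (3 / 4) ^ (k * m))

/-- The error term. -/
def eps (k K m : ℕ) : ℝ :=
  (m : ℝ) ^ 3 * X3 m * 2 ^ (3 * 3) / (2 ^ m) ^ 3 + (m : ℝ) ^ K * XK k K m * 2 ^ (K * K) / (2 ^ m) ^ K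

lemma pow125 (m : ℕ) : (125 : ℝ) ^ (3 * m / 100) ≤ (6 / 5) ^ m := by
  rw [← pow_le_pow_iff_left₀ (by positivity) (by positivity) (show 100 ≠ 0 by norm_num)]
  calc ((125 : ℝ) ^ (3 * m / 100)) ^ 100 = 125 ^ (3 * m / 100 * 100) := by rw [← pow_mul]
    _ ≤ 125 ^ (3 * m) := pow_le_pow_right₀ (by norm_num) (Nat.div_mul_le_self _ _)
    _ = (125 ^ 3) ^ m := by rw [pow_mul]
    _ ≤ ((6 / 5) ^ 100) ^ m := by
        refine pow_le_pow_left₀ (by norm_num) (by norm_num) _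
    _ = _ := by rw [← pow_mul, ← pow_mul, mul_comm]

lemma tendsto_eps (k K : ℕ) (hk : (4 * ((K : ℝ) + 1)) * (3 / 4) ^ k ≤ 1 / 2) :
    Tendsto (eps k K) atTop (nhds 0) := by
  have h3 : Tendsto (fun m : ℕ => (m : ℝ) ^ 3 * X3 m * 2 ^ (3 * 3) / (2 ^ m) ^ 3) atTop (nhds 0) := by
    have hl := (subexp_lim 3 (9 / 10) (by norm_num) (by norm_num)).const_mul
      ((125 : ℝ) ^ 3 * 2 ^ (3 * 3))
    rw [mul_zero] at hl
    refine squeeze_zero (fun m => by unfold X3; positivity) (fun m => ?_) hl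
    have e1 : (m : ℝ) ^ 3 ≤ (4 * (m : ℝ) + 1) ^ 3 := by
      refine pow_le_pow_left₀ (by positivity) ?_ _
      linarith [(Nat.cast_nonneg m : (0 : ℝ) ≤ m)]
    have e2 := pow125 m
    rw [div_le_iff₀ (by positivity)]
    unfold X3
    calc (m : ℝ) ^ 3 * (((4 * (m : ℝ) + 1) ^ (Nat.sqrt m + 1)) ^ 3 *
          (6 ^ m * 125 ^ (3 + 3 * m / 100))) * 2 ^ (3 * 3)
        ≤ (4 * (m : ℝ) + 1) ^ 3 * (((4 * (m : ℝ) + 1) ^ (Nat.sqrt m + 1)) ^ 3 *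
          (6 ^ m * (125 ^ 3 * (6 / 5) ^ m))) * 2 ^ (3 * 3) := by
          have e3 : (125 : ℝ) ^ (3 + 3 * m / 100) ≤ 125 ^ 3 * (6 / 5) ^ m := by
            rw [pow_add]
            exact mul_le_mul_of_nonneg_left e2 (by positivity)
          gcongr
      _ = 125 ^ 3 * 2 ^ (3 * 3) * ((4 * (m : ℝ) + 1) ^ (3 * (Nat.sqrt m + 2)) *
          (6 * (6 / 5)) ^ m) := by
          rw [mul_pow]
          ring
      _ = _ := by
          have : ((6 : ℝ) * (6 / 5)) ^ m = (9 / 10) ^ m * (2 ^ m) ^ 3 := by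
            rw [← pow_mul, mul_comm m 3, pow_mul, ← mul_pow]
            norm_num
          rw [this]
          ring
  have hKt : Tendsto (fun m : ℕ => (m : ℝ) ^ K * XK k K m * 2 ^ (K * K) / (2 ^ m) ^ K)
      atTop (nhds 0) := by
    have hl := (subexp_lim (2 * K) (1 / 2) (by norm_num) (by norm_num)).const_mul
      (((5 : ℝ) ^ K) ^ K * 2 ^ (K * K))
    rw [mul_zero] at hl
    refine squeeze_zero (fun m => by unfold XK; positivity) (fun m => ?_) hl
    have e0 : (0 : ℝ) ≤ m := Nat.cast_nonneg m
    have e1 : (m : ℝ) ^ K ≤ (4 * (m : ℝ) + 1) ^ K * (4 * (m : ℝ) + 1) ^ K := by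
      have h1 : (m : ℝ) ^ K ≤ (4 * (m : ℝ) + 1) ^ K :=
        pow_le_pow_left₀ (by positivity) (by linarith) _
      have h2 : (1 : ℝ) ≤ (4 * (m : ℝ) + 1) ^ K := one_le_pow₀ (by linarith)
      nlinarith
    have e2 : ((4 * ((K : ℝ) + 1)) * (3 / 4) ^ k) ^ m ≤ (1 / 2) ^ m :=
      pow_le_pow_left₀ (by positivity) hk _
    rw [div_le_iff₀ (by positivity)]
    unfold XK
    set x := 4 * (m : ℝ) + 1 with hx
    have hx0 : 0 ≤ x := by positivity
    set s := Nat.sqrt m with hs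
    have e3 : (2 : ℝ) ^ m * (2 * ((K : ℝ) + 1)) ^ m * (3 / 4) ^ (k * m) ≤ (1 / 2) ^ m := by
      refine le_trans (le_of_eq ?_) e2
      rw [pow_mul, ← mul_pow, ← mul_pow]
      congr 1
      ring
    calc (m : ℝ) ^ K * ((2 ^ m * (2 * ((K : ℝ) + 1)) ^ m * ((x ^ (s + 1)) ^ K * (x ^ (s + 1)) ^ K)) *
          ((2 ^ m * 5 ^ K) ^ K * (3 / 4) ^ (k * m))) * 2 ^ (K * K)
        = (m : ℝ) ^ K * ((2 : ℝ) ^ m * (2 * ((K : ℝ) + 1)) ^ m * (3 / 4) ^ (k * m)) *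
          (((x ^ (s + 1)) ^ K * (x ^ (s + 1)) ^ K) * (2 ^ m * 5 ^ K) ^ K * 2 ^ (K * K)) := by ring
      _ ≤ (x ^ K * x ^ K) * (1 / 2) ^ m *
          (((x ^ (s + 1)) ^ K * (x ^ (s + 1)) ^ K) * (2 ^ m * 5 ^ K) ^ K * 2 ^ (K * K)) := by
          refine mul_le_mul_of_nonneg_right ?_ (by positivity)
          exact mul_le_mul e1 e3 (by positivity) (by positivity)
      _ = _ := by
          have h1 : x ^ (2 * K * (s + 2)) = (x ^ K * x ^ K) * ((x ^ (s + 1)) ^ K * (x ^ (s + 1)) ^ K) := by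
            rw [← pow_mul, ← pow_add, ← pow_add, ← pow_add]
            congr 1
            ring
          rw [h1, mul_pow (2 ^ m : ℝ)]
          ring
  have := h3.add hKt
  rw [add_zero] at this
  exact this

lemma eps_nonneg (k K m : ℕ) : 0 ≤ eps k K m := by
  unfold eps X3 XK
  positivity

lemma CC_rec {n k K : ℕ} (hK : K = 100 * k) (hK0 : 0 < K) (A : Finset (Fin n))
    (hm : 100 * K ≤ A.card) (B : ℝ) (hB : 0 ≤ B)
    (ih : ∀ A' : Finset (Fin n), A'.card < A.card → ((CC A').card : ℝ) ≤ B * 2 ^ T A'.card) :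
    ((CC A).card : ℝ) ≤ (1 + eps k K A.card * B) * 2 ^ T A.card := by
  set m := A.card with hmdef
  set d := Nat.sqrt m + 1 with hd
  have hdd : A.card < d * d := Nat.lt_succ_sqrt m
  have gen : ∀ (K' : ℕ) (X : ℝ) (Z : (Fin K' → Fin n) → Finset (St n)), 0 < K' → 0 ≤ X →
      (∀ e ∈ IJ A K', ((Z e).card : ℝ) ≤ X * (CC (A \ univ.image e)).card) →
      (((IJ A K').biUnion Z).card : ℝ) ≤
        ((m : ℝ) ^ K' * X * 2 ^ (K' * K') / (2 ^ m) ^ K') * B * 2 ^ T m := by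
    intro K' X Z hK' hX hZ
    calc (((IJ A K').biUnion Z).card : ℝ) ≤ ∑ e ∈ IJ A K', ((Z e).card : ℝ) := by
          exact_mod_cast card_biUnion_le
      _ ≤ ∑ e ∈ IJ A K', (X * B * (2 ^ (K' * K') * 2 ^ T m / (2 ^ m) ^ K')) := by
          refine sum_le_sum fun e he => (hZ e he).trans ?_
          have hc := card_IJ_sdiff he
          have h1 := ih (A \ univ.image e) (by omega)
          have h2 := two_pow_T m _ K' hc
          rw [← le_div_iff₀ (by positivity)] at h2
          calc X * ((CC (A \ univ.image e)).card : ℝ) ≤ X * (B * 2 ^ T (A \ univ.image e).card) :=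
                mul_le_mul_of_nonneg_left h1 hX
            _ ≤ X * (B * (2 ^ (K' * K') * 2 ^ T m / (2 ^ m) ^ K')) := by
                gcongr
            _ = _ := by ring
      _ = (IJ A K').card * (X * B * (2 ^ (K' * K') * 2 ^ T m / (2 ^ m) ^ K')) := by
          rw [sum_const, nsmul_eq_mul]
      _ ≤ (m : ℝ) ^ K' * (X * B * (2 ^ (K' * K') * 2 ^ T m / (2 ^ m) ^ K')) := by
          refine mul_le_mul_of_nonneg_right ?_ (by positivity)
          exact_mod_cast card_IJ A K'
      _ = _ := by ring
  have g3 := gen 3 (X3 m) (TT A d) (by norm_num) (by unfold X3; positivity) (by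
    intro e _
    have := card_TT A d hdd e
    have h2 : ((TT A d e).card : ℝ) ≤ ((((4 * A.card + 1) ^ d) ^ 3 *
      (6 ^ A.card * 125 ^ (3 + 3 * A.card / 100))) * (CC (A \ univ.image e)).card : ℕ) := by
      exact_mod_cast this
    push_cast at h2
    exact h2)
  have gK := gen K (XK k K m) (SS A d) hK0 (by unfold XK; positivity) (by
    intro e _
    have h2 := card_SS hK A d hdd e
    push_cast at h2
    exact h2)
  have hU : ((UU A).card : ℝ) ≤ 2 ^ T m := by exact_mod_cast card_UU A
  have hcov : ((CC A).card : ℝ) ≤ (UU A).card + (((IJ A 3).biUnion (TT A d)).card +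
      ((IJ A K).biUnion (SS A d)).card) := by
    have h1 := card_le_card (cover A d K hm)
    have h2 := card_union_le (UU A) ((IJ A 3).biUnion (TT A d) ∪ (IJ A K).biUnion (SS A d))
    have h3 := card_union_le ((IJ A 3).biUnion (TT A d)) ((IJ A K).biUnion (SS A d))
    exact_mod_cast (h1.trans (h2.trans (Nat.add_le_add_left h3 _)))
  unfold eps
  linarith

/-- Bootstrapping a recursive bound. -/
lemma boot (a : ∀ n : ℕ, Finset (Fin n) → ℝ) (t ε : ℕ → ℝ) (m0 : ℕ) (ht0 : ∀ m, 0 ≤ t m)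
    (ht : ∀ n (A : Finset (Fin n)), a n A ≤ t A.card) (hε : Tendsto ε atTop (nhds 0))
    (hε0 : ∀ m, 0 ≤ ε m)
    (hrec : ∀ n (A : Finset (Fin n)) (B : ℝ), m0 ≤ A.card → 1 ≤ B →
      (∀ A' : Finset (Fin n), A'.card < A.card → a n A' ≤ B * 2 ^ T A'.card) →
      a n A ≤ (1 + ε A.card * B) * 2 ^ T A.card) :
    ∃ δ : ℕ → ℝ, Tendsto δ atTop (nhds 0) ∧ (∀ m, 0 ≤ δ m) ∧
      ∀ n (A : Finset (Fin n)), m0 ≤ A.card → a n A ≤ (1 + δ A.card) * 2 ^ T A.card := by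
  obtain ⟨m1, hm1⟩ := eventually_atTop.1 (hε.eventually (gt_mem_nhds (show (0 : ℝ) < 1 / 2 by norm_num)))
  let M := m0 + m1
  let B : ℝ := 2 + ∑ m ∈ range M, t m
  have hB2 : 2 ≤ B := by
    have : 0 ≤ ∑ m ∈ range M, t m := sum_nonneg fun m _ => ht0 m
    simp only [B]; linarith
  have hall : ∀ m n (A : Finset (Fin n)), A.card = m → a n A ≤ B * 2 ^ T A.card := by
    intro m
    induction m using Nat.strong_induction_on with
    | _ m ih =>
    intro n A hA
    by_cases hM : m < M
    · have h1 : t m ≤ ∑ m ∈ range M, t m :=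
        single_le_sum (f := t) (fun m _ => ht0 m) (mem_range.2 hM)
      have h2 := ht n A
      have h3 : (1 : ℝ) ≤ 2 ^ T A.card := one_le_pow₀ (by norm_num)
      rw [hA] at h2
      have h4 : a n A ≤ B := by simp only [B]; linarith
      nlinarith
    · have h1 := hrec n A B (by omega) (by linarith) (fun A' hA' => ih _ (hA ▸ hA') n A' rfl)
      refine h1.trans ?_
      have h2 := hm1 A.card (by omega)
      have h3 := hε0 A.card
      refine mul_le_mul_of_nonneg_right ?_ (by positivity)
      nlinarith
  refine ⟨fun m => ε m * B, ?_, fun m => mul_nonneg (hε0 m) (by linarith), ?_⟩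
  · have := hε.mul_const B
    rwa [zero_mul] at this
  · intro n A hA
    exact hrec n A B hA (by linarith) (fun A' _ => hall _ n A' rfl)

lemma CC_bound : ∃ (m0 : ℕ) (δ : ℕ → ℝ), Tendsto δ atTop (nhds 0) ∧ (∀ m, 0 ≤ δ m) ∧
    ∀ n (A : Finset (Fin n)), m0 ≤ A.card → ((CC A).card : ℝ) ≤ (1 + δ A.card) * 2 ^ T A.card := by
  obtain ⟨k, hk0, hk⟩ : ∃ k : ℕ, 0 < k ∧ (4 * (((100 * k : ℕ) : ℝ) + 1)) * (3 / 4) ^ k ≤ 1 / 2 :=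
    ⟨40, by norm_num, by norm_num⟩
  refine ⟨100 * (100 * k), boot (fun n A => ((CC A).card : ℝ)) (fun m => (5 ^ m) ^ m)
    (eps k (100 * k)) _ (fun m => by positivity) ?_ (tendsto_eps k _ hk) (eps_nonneg k _) ?_⟩
  · intro n A
    exact_mod_cast card_CC_triv A
  · intro n A B hm hB ih
    exact CC_rec rfl (by omega) A hm B (by linarith) ih

/-! ### From structures to functions -/

/-- Satisfaction of a clause. -/
def Cs {n : ℕ} (c : Literal n × Literal n) (σ : Fin n → Bool) : Prop :=
  σ c.1.1 = c.1.2 ∨ σ c.2.1 = c.2.2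

/-- The function defined by a set of clauses. -/
def ev {n : ℕ} (F : Finset (Literal n × Literal n)) : (Fin n → Bool) → Bool :=
  fun σ => decide (∀ c ∈ F, Cs c σ)

/-- All clauses with variables in `A`. -/
def CL {n : ℕ} (A : Finset (Fin n)) : Finset (Literal n × Literal n) :=
  (A ×ˢ univ) ×ˢ (A ×ˢ univ)

lemma mem_CL {n : ℕ} {A : Finset (Fin n)} {c : Literal n × Literal n} :
    c ∈ CL A ↔ c.1.1 ∈ A ∧ c.2.1 ∈ A := by
  simp [CL]

/-- All functions definable over `A`. -/
def FF {n : ℕ} (A : Finset (Fin n)) : Finset ((Fin n → Bool) → Bool) := (CL A).powerset.image ev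

lemma card_FF_triv {n : ℕ} (A : Finset (Fin n)) :
    (FF A).card ≤ 2 ^ ((A.card * 2) * (A.card * 2)) := by
  refine card_image_le.trans (le_of_eq ?_)
  rw [card_powerset, CL, card_product, card_product]
  simp

/-- Adding a forced variable. -/
def fo {n : ℕ} (i : Fin n) (a : Bool) (g : (Fin n → Bool) → Bool) : (Fin n → Bool) → Bool :=
  fun σ => decide (σ i = a) && g σ

/-- Adding an equivalence of variables. -/
def eqv {n : ℕ} (i j : Fin n) (b : Bool) (g : (Fin n → Bool) → Bool) : (Fin n → Bool) → Bool :=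
  fun σ => decide (xor (σ i) (σ j) = b) && g σ

/-- The function of a structure. -/
def evS {n : ℕ} (c : St n) : (Fin n → Bool) → Bool := fun σ => decide (Sat c σ)

lemma forced_case {n : ℕ} {A : Finset (Fin n)} {F : Finset (Literal n × Literal n)} (hF : F ⊆ CL A)
    (hsat : ∃ σ, ev F σ = true) {i : Fin n} {a : Bool} (h : ∀ σ, ev F σ = true → σ i = a) :
    ∃ g ∈ FF (A.erase i), fo i a g = ev F := by
  refine ⟨ev ((CL (A.erase i)).filter (fun c => ∀ σ, ev F σ = true → Cs c σ)),
    mem_image_of_mem _ (mem_powerset.2 (filter_subset _ _)), ?_⟩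
  funext σ
  rw [Bool.eq_iff_iff]
  simp only [fo, Bool.and_eq_true, decide_eq_true_eq]
  constructor
  · rintro ⟨h1, h2⟩
    simp only [ev, decide_eq_true_eq, mem_filter, mem_CL, mem_erase] at h2 h hsat ⊢
    rintro ⟨⟨u, x⟩, ⟨w, y⟩⟩ hc
    have hcA := mem_CL.1 (hF hc)
    simp only at hcA
    by_cases hu : u = i
    · subst hu
      by_cases hx : x = a
      · exact Or.inl (h1.trans hx.symm)
      by_cases hw : w = u
      · subst hw
        by_cases hy : y = a
        · exact Or.inr (h1.trans hy.symm)
        · exfalso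
          obtain ⟨τ, hτ⟩ := hsat
          have e1 := h τ hτ
          rcases hτ _ hc with e | e
          · exact hx (e.symm.trans e1)
          · exact hy (e.symm.trans e1)
      · right
        have := h2 ((w, y), (w, y)) ⟨⟨⟨hw, hcA.2⟩, ⟨hw, hcA.2⟩⟩, fun τ hτ => ?_⟩
        · simpa [Cs] using this
        · rcases hτ _ hc with e | e
          · exact absurd (e.symm.trans (h τ hτ)) hx
          · exact Or.inl e
    · by_cases hw : w = i
      · subst hw
        by_cases hy : y = a
        · exact Or.inr (h1.trans hy.symm)
        left
        have := h2 ((u, x), (u, x)) ⟨⟨⟨hu, hcA.1⟩, ⟨hu, hcA.1⟩⟩, fun τ hτ => ?_⟩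
        · simpa [Cs] using this
        · rcases hτ _ hc with e | e
          · exact Or.inl e
          · exact absurd (e.symm.trans (h τ hτ)) hy
      · exact h2 _ ⟨⟨⟨hu, hcA.1⟩, ⟨hw, hcA.2⟩⟩, fun τ hτ => hτ _ hc⟩
  · intro h1
    refine ⟨h σ h1, ?_⟩
    simp only [ev, decide_eq_true_eq]
    intro c hc
    exact (mem_filter.1 hc).2 σ (by simpa [ev] using h1)

lemma equiv_case {n : ℕ} {A : Finset (Fin n)} {F : Finset (Literal n × Literal n)} (hF : F ⊆ CL A)
    {i j : Fin n} (hj : j ∈ A) (hij : i ≠ j) {b : Bool}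
    (h : ∀ σ, ev F σ = true → xor (σ i) (σ j) = b) :
    ∃ g ∈ FF (A.erase i), eqv i j b g = ev F := by
  refine ⟨ev ((CL (A.erase i)).filter (fun c => ∀ σ, ev F σ = true → Cs c σ)),
    mem_image_of_mem _ (mem_powerset.2 (filter_subset _ _)), ?_⟩
  let φ : Literal n → Literal n := fun l => if l.1 = i then (j, xor l.2 b) else l
  have hφ : ∀ σ : Fin n → Bool, xor (σ i) (σ j) = b → ∀ l : Literal n,
      (σ (φ l).1 = (φ l).2 ↔ σ l.1 = l.2) := by
    rintro σ hσ ⟨u, x⟩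
    simp only [φ]
    split_ifs with hu
    · subst hu
      simp only
      rw [← hσ]
      cases σ u <;> cases σ j <;> cases x <;> simp
    · rfl
  have hφA : ∀ l : Literal n, l.1 ∈ A → (φ l).1 ∈ A.erase i := by
    intro l hl
    simp only [φ]
    split_ifs with hu
    · exact mem_erase.2 ⟨hij.symm, hj⟩
    · exact mem_erase.2 ⟨hu, hl⟩
  funext σ
  rw [Bool.eq_iff_iff]
  simp only [eqv, Bool.and_eq_true, decide_eq_true_eq]
  constructor
  · rintro ⟨h1, h2⟩
    simp only [ev, decide_eq_true_eq, mem_filter, mem_CL] at h2 h ⊢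
    intro c hc
    have hcA := mem_CL.1 (hF hc)
    have := h2 (φ c.1, φ c.2) ⟨⟨hφA _ hcA.1, hφA _ hcA.2⟩, fun τ hτ => ?_⟩
    · unfold Cs at this ⊢
      rwa [hφ σ h1, hφ σ h1] at this
    · unfold Cs
      rw [hφ τ (h τ hτ), hφ τ (h τ hτ)]
      exact hτ c hc
  · intro h1
    refine ⟨h σ h1, ?_⟩
    simp only [ev, decide_eq_true_eq]
    intro c hc
    exact (mem_filter.1 hc).2 σ (by simpa [ev] using h1)

lemma elem_case {n : ℕ} {A : Finset (Fin n)} {F : Finset (Literal n × Literal n)} (hF : F ⊆ CL A)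
    (hfree : ∀ i ∈ A, ∀ a, ∃ σ, ev F σ = true ∧ σ i = a)
    (hne : ∀ i ∈ A, ∀ j ∈ A, i ≠ j → ∀ b, ∃ σ, ev F σ = true ∧ xor (σ i) (σ j) = b) :
    ∃ c ∈ CC A, evS c = ev F := by
  let I : Fin n → Bool → Fin n → Bool → Prop := fun u a w b =>
    ∀ σ, ev F σ = true → σ u = a ∨ σ w = b
  have huniq : ∀ u ∈ A, ∀ w ∈ A, u ≠ w → ∀ a b a' b', I u a w b → I u a' w b' →
      a = a' ∧ b = b' := by
    intro u hu w hw huw a b a' b' h1 h2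
    by_cases ha : a = a'
    · refine ⟨ha, ?_⟩
      subst ha
      by_contra hb
      obtain ⟨σ, hσ, e⟩ := hfree u hu (!a)
      have e1 := h1 σ hσ
      have e2 := h2 σ hσ
      rw [e] at e1 e2
      have e1 := e1.resolve_left (by simp)
      have e2 := e2.resolve_left (by simp)
      exact hb (e1.symm.trans e2)
    · exfalso
      by_cases hb : b = b'
      · subst hb
        obtain ⟨σ, hσ, e⟩ := hfree w hw (!b)
        have e1 := h1 σ hσ
        have e2 := h2 σ hσ
        rw [e] at e1 e2
        have e1 := e1.resolve_right (by simp)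
        have e2 := e2.resolve_right (by simp)
        exact ha (e1.symm.trans e2)
      · obtain ⟨σ, hσ, e⟩ := hne u hu w hw huw (xor a b)
        exact bool_aux1 a b a' b' (σ u) (σ w) (Ne.symm ha) (Ne.symm hb)
          ⟨h1 σ hσ, h2 σ hσ⟩ e
  let R : Finset (St n) := univ.filter (fun c =>
    (∀ u w a b, c u w = some (a, b) → c w u = some (b, a)) ∧ (∀ u, c u u = none) ∧
    (∀ u w a b, c u w = some (a, b) → u ∈ A) ∧ ∀ σ, Sat c σ ↔ ev F σ = true)
  have hR : R.Nonempty := by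
    let c0 : St n := fun u w =>
      if h : u ≠ w ∧ u ∈ A ∧ w ∈ A ∧ ∃ p : Bool × Bool, I u p.1 w p.2 then
        some (Classical.choose h.2.2.2) else none
    have hc0 : ∀ u w a b, c0 u w = some (a, b) ↔ u ≠ w ∧ u ∈ A ∧ w ∈ A ∧ I u a w b := by
      intro u w a b
      simp only [c0]
      split_ifs with h
      · have hsp := Classical.choose_spec h.2.2.2
        constructor
        · intro he
          rw [Option.some.injEq] at he
          rw [he] at hsp
          exact ⟨h.1, h.2.1, h.2.2.1, hsp⟩
        · rintro ⟨-, -, -, h4⟩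
          have := huniq u h.2.1 w h.2.2.1 h.1 _ _ _ _ hsp h4
          rw [Option.some.injEq]
          exact Prod.ext this.1 this.2
      · constructor
        · intro he; simp at he
        · rintro ⟨h1, h2, h3, h4⟩
          exact absurd ⟨h1, h2, h3, (a, b), h4⟩ h
    refine ⟨c0, ?_⟩
    simp only [R, mem_filter, mem_univ, true_and]
    refine ⟨?_, ?_, ?_, ?_⟩
    · intro u w a b h
      rw [hc0] at h ⊢
      exact ⟨h.1.symm, h.2.2.1, h.2.1, fun σ hσ => (h.2.2.2 σ hσ).symm⟩
    · intro u
      simp [c0]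
    · intro u w a b h
      exact ((hc0 _ _ _ _).1 h).2.1
    · intro σ
      constructor
      · intro hσ
        simp only [ev, decide_eq_true_eq]
        rintro ⟨⟨u, x⟩, ⟨w, y⟩⟩ hc
        have hcA := mem_CL.1 (hF hc)
        simp only at hcA
        have hI : I u x w y := by
          intro τ hτ
          simp only [ev, decide_eq_true_eq] at hτ
          exact hτ _ hc
        by_cases huw : u = w
        · subst huw
          by_cases hxy : x = y
          · subst hxy
            exfalso
            obtain ⟨τ, hτ, e⟩ := hfree u hcA.1 (!x)
            have := hI τ hτ
            rw [e] at this
            simp at this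
          · unfold Cs
            simp only
            revert hxy
            cases x <;> cases y <;> cases σ u <;> simp
        · exact hσ u w x y ((hc0 _ _ _ _).2 ⟨huw, hcA.1, hcA.2, hI⟩)
      · intro hσ u w a b h
        exact ((hc0 _ _ _ _).1 h).2.2.2 σ hσ
  let N : St n → ℕ := fun c => (univ.filter (fun p : Fin n × Fin n => c p.1 p.2 ≠ none)).card
  obtain ⟨c, hcR, hmin⟩ := exists_min_image R N hR
  obtain ⟨hsym, hirr, hsupp, hc⟩ := (mem_filter.1 hcR).2
  refine ⟨c, mem_CC.2 ⟨hsym, hirr, hsupp, ?_, ?_, ?_⟩, ?_⟩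
  · intro i hi a
    obtain ⟨σ, h1, h2⟩ := hfree i hi a
    exact ⟨σ, (hc σ).2 h1, h2⟩
  · intro i hi j hj hij b
    obtain ⟨σ, h1, h2⟩ := hne i hi j hj hij b
    exact ⟨σ, (hc σ).2 h1, h2⟩
  · intro u w a b huw
    let c1 : St n := fun u' w' => if (u' = u ∧ w' = w) ∨ (u' = w ∧ w' = u) then none else c u' w'
    have hc1 : ∀ u' w' a' b', c1 u' w' = some (a', b') ↔
        c u' w' = some (a', b') ∧ ¬ (u' = u ∧ w' = w) ∧ ¬ (u' = w ∧ w' = u) := by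
      intro u' w' a' b'
      simp only [c1]
      split_ifs with h
      · constructor
        · intro he; simp at he
        · rintro ⟨-, h1, h2⟩
          exact absurd h (by tauto)
      · push Not at h
        tauto
    have hlt : N c1 < N c := by
      refine card_lt_card ?_
      rw [ssubset_iff_of_subset]
      · refine ⟨(u, w), ?_, ?_⟩
        · simp [huw]
        · simp [c1]
      · intro p hp
        simp only [mem_filter, mem_univ, true_and, c1] at hp ⊢
        split_ifs at hp with h
        · simp at hp
        · exact hp
    have hnot : c1 ∉ R := fun h => by
      have := hmin _ h
      omega
    have hex : ∃ σ, Sat c1 σ ∧ ¬ Sat c σ := by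
      by_contra hcon
      push Not at hcon
      refine hnot (mem_filter.2 ⟨mem_univ _, ?_, ?_, ?_, ?_⟩)
      · intro u' w' a' b' h
        rw [hc1] at h ⊢
        exact ⟨hsym _ _ _ _ h.1, by tauto, by tauto⟩
      · intro u'
        simp only [c1]
        split_ifs
        · rfl
        · exact hirr u'
      · intro u' w' a' b' h
        exact hsupp _ _ _ _ ((hc1 _ _ _ _).1 h).1
      · intro σ
        rw [← hc σ]
        exact ⟨hcon σ, fun h u' w' a' b' h' => h _ _ _ _ ((hc1 _ _ _ _).1 h').1⟩
    obtain ⟨σ, h1, h2⟩ := hex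
    have hviol : ¬ (σ u = a ∨ σ w = b) := by
      intro hor
      refine h2 fun u' w' a' b' h => ?_
      by_cases e1 : u' = u ∧ w' = w
      · obtain ⟨rfl, rfl⟩ := e1
        rw [huw] at h
        simp only [Option.some.injEq, Prod.mk.injEq] at h
        rw [← h.1, ← h.2]
        exact hor
      by_cases e2 : u' = w ∧ w' = u
      · obtain ⟨rfl, rfl⟩ := e2
        rw [hsym _ _ _ _ huw] at h
        simp only [Option.some.injEq, Prod.mk.injEq] at h
        rw [← h.1, ← h.2]
        exact hor.symm
      exact h1 _ _ _ _ ((hc1 _ _ _ _).2 ⟨h, e1, e2⟩)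
    push Not at hviol
    refine ⟨σ, Bool.eq_not.2 hviol.1, Bool.eq_not.2 hviol.2, ?_⟩
    intro u' w' a' b' h e1 e2
    exact h1 _ _ _ _ ((hc1 _ _ _ _).2 ⟨h, e1, e2⟩)
  · funext σ
    rw [Bool.eq_iff_iff]
    simp only [evS, decide_eq_true_eq]
    exact hc σ

lemma FF_cover {n : ℕ} (A : Finset (Fin n)) :
    FF A ⊆ {fun _ => false} ∪
      ((A ×ˢ (univ : Finset Bool)).biUnion (fun p => (FF (A.erase p.1)).image (fo p.1 p.2)) ∪
      ((A ×ˢ (A ×ˢ (univ : Finset Bool))).biUnion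
        (fun p => (FF (A.erase p.1)).image (eqv p.1 p.2.1 p.2.2)) ∪ (CC A).image evS)) := by
  intro f hf
  obtain ⟨F, hF, rfl⟩ := mem_image.1 hf
  rw [mem_powerset] at hF
  simp only [mem_union]
  by_cases hsat : ∃ σ, ev F σ = true
  swap
  · left
    rw [mem_singleton]
    push Not at hsat
    funext σ
    simpa using hsat σ
  right
  by_cases h1 : ∃ i ∈ A, ∃ a, ∀ σ, ev F σ = true → σ i = a
  · left
    obtain ⟨i, hi, a, h⟩ := h1
    rw [mem_biUnion]
    exact ⟨(i, a), by simp [hi], mem_image.2 (forced_case hF hsat h)⟩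
  right
  by_cases h2 : ∃ i ∈ A, ∃ j ∈ A, i ≠ j ∧ ∃ b, ∀ σ, ev F σ = true → xor (σ i) (σ j) = b
  · left
    obtain ⟨i, hi, j, hj, hij, b, h⟩ := h2
    rw [mem_biUnion]
    exact ⟨(i, j, b), by simp [hi, hj], mem_image.2 (equiv_case hF hj hij h)⟩
  right
  rw [mem_image]
  refine elem_case hF ?_ ?_
  · intro i hi a
    by_contra hcon
    push Not at hcon
    exact h1 ⟨i, hi, !a, fun σ hσ => Bool.eq_not.2 (hcon σ hσ)⟩
  · intro i hi j hj hij b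
    by_contra hcon
    push Not at hcon
    exact h2 ⟨i, hi, j, hj, hij, !b, fun σ hσ => Bool.eq_not.2 (hcon σ hσ)⟩

lemma FF_rec {n : ℕ} (A : Finset (Fin n)) (hA : 0 < A.card) (B δ : ℝ) (hB : 1 ≤ B) (hδ : 0 ≤ δ)
    (hCC : ((CC A).card : ℝ) ≤ (1 + δ) * 2 ^ T A.card)
    (ih : ∀ A' : Finset (Fin n), A'.card < A.card → ((FF A').card : ℝ) ≤ B * 2 ^ T A'.card) :
    ((FF A).card : ℝ) ≤ (1 + (δ + (1 + 2 * A.card + 2 * (A.card : ℝ) ^ 2) * (1 / 2) ^ A.card) * B) *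
      2 ^ T A.card := by
  set m := A.card with hm
  set Q : ℝ := B * ((1 / 2) ^ m * 2 ^ T m) with hQ
  have hT : T m = T (m - 1) + m := by
    have := T_add (m - 1) 1
    rw [Nat.sub_add_cancel hA] at this
    rw [this]
    simp [T]
    omega
  have hTm : (2 : ℝ) ^ T (m - 1) = (1 / 2) ^ m * 2 ^ T m := by
    rw [hT, pow_add, mul_comm ((2 : ℝ) ^ T (m - 1)), ← mul_assoc, ← mul_pow]
    norm_num
  have hih : ∀ i ∈ A, ((FF (A.erase i)).card : ℝ) ≤ Q := by
    intro i hi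
    have hc := card_erase_of_mem hi
    have := ih (A.erase i) (by rw [hc]; omega)
    rw [hc, ← hm, hTm] at this
    exact this
  have h1 : ((((A ×ˢ (univ : Finset Bool)).biUnion
      (fun p => (FF (A.erase p.1)).image (fo p.1 p.2))).card : ℕ) : ℝ) ≤ 2 * m * Q := by
    calc _ ≤ ∑ p ∈ A ×ˢ (univ : Finset Bool), (((FF (A.erase p.1)).image (fo p.1 p.2)).card : ℝ) := by
          exact_mod_cast card_biUnion_le
      _ ≤ ∑ p ∈ A ×ˢ (univ : Finset Bool), Q := by
          refine sum_le_sum fun p hp => ?_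
          refine le_trans ?_ (hih p.1 (mem_product.1 hp).1)
          exact_mod_cast card_image_le
      _ = _ := by
          rw [sum_const, nsmul_eq_mul, card_product, ← hm, card_univ, Fintype.card_bool]
          push_cast
          ring
  have h2 : ((((A ×ˢ (A ×ˢ (univ : Finset Bool))).biUnion
      (fun p => (FF (A.erase p.1)).image (eqv p.1 p.2.1 p.2.2))).card : ℕ) : ℝ) ≤
        2 * (m : ℝ) ^ 2 * Q := by
    calc _ ≤ ∑ p ∈ A ×ˢ (A ×ˢ (univ : Finset Bool)),
            (((FF (A.erase p.1)).image (eqv p.1 p.2.1 p.2.2)).card : ℝ) := by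
          exact_mod_cast card_biUnion_le
      _ ≤ ∑ p ∈ A ×ˢ (A ×ˢ (univ : Finset Bool)), Q := by
          refine sum_le_sum fun p hp => ?_
          refine le_trans ?_ (hih p.1 (mem_product.1 hp).1)
          exact_mod_cast card_image_le
      _ = _ := by
          rw [sum_const, nsmul_eq_mul, card_product, card_product, ← hm, card_univ, Fintype.card_bool]
          push_cast
          ring
  have h3 : (((CC A).image evS).card : ℝ) ≤ (1 + δ) * 2 ^ T m := by
    refine le_trans ?_ hCC
    exact_mod_cast card_image_le
  have h0 : (1 : ℝ) ≤ Q := by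
    have : (1 : ℝ) ≤ 2 ^ T (m - 1) := one_le_pow₀ (by norm_num)
    rw [hQ, ← hTm]
    nlinarith
  have hcard : ((FF A).card : ℝ) ≤ 1 + (2 * m * Q + (2 * (m : ℝ) ^ 2 * Q + (1 + δ) * 2 ^ T m)) := by
    have e0 := card_le_card (FF_cover A)
    have e1 := e0.trans ((card_union_le _ _).trans (Nat.add_le_add_left ((card_union_le _ _).trans
      (Nat.add_le_add_left (card_union_le _ _) _)) _))
    have e2 : ((FF A).card : ℝ) ≤ _ := Nat.cast_le.2 e1
    push_cast [card_singleton] at e2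
    linarith
  have h4 : δ * 2 ^ T m ≤ δ * B * 2 ^ T m := by
    refine mul_le_mul_of_nonneg_right ?_ (by positivity)
    nlinarith
  calc ((FF A).card : ℝ) ≤ Q + (2 * m * Q + (2 * (m : ℝ) ^ 2 * Q + (1 * 2 ^ T m + δ * B * 2 ^ T m))) := by
        linarith
    _ = _ := by
        rw [hQ]; ring

lemma FF_bound : ∃ (m0 : ℕ) (δ : ℕ → ℝ), Tendsto δ atTop (nhds 0) ∧ (∀ m, 0 ≤ δ m) ∧
    ∀ n (A : Finset (Fin n)), m0 ≤ A.card → ((FF A).card : ℝ) ≤ (1 + δ A.card) * 2 ^ T A.card := by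
  obtain ⟨m0, δ, hδ, hδ0, hCC⟩ := CC_bound
  refine ⟨m0 + 1, boot (fun n A => ((FF A).card : ℝ)) (fun m => 2 ^ ((m * 2) * (m * 2)))
    (fun m => δ m + (1 + 2 * m + 2 * (m : ℝ) ^ 2) * (1 / 2) ^ m) _ (fun m => by positivity) ?_ ?_ ?_ ?_⟩
  · intro n A
    exact_mod_cast card_FF_triv A
  · have ha : |(1 / 2 : ℝ)| < 1 := by rw [abs_of_nonneg] <;> norm_num
    have p0 := tendsto_pow_const_mul_const_pow_of_abs_lt_one 0 ha
    have p1 := (tendsto_pow_const_mul_const_pow_of_abs_lt_one 1 ha).const_mul 2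
    have p2 := (tendsto_pow_const_mul_const_pow_of_abs_lt_one 2 ha).const_mul 2
    have := hδ.add (p0.add (p1.add p2))
    simp only [mul_zero, add_zero] at this
    refine this.congr fun m => ?_
    simp only [pow_zero, pow_one]
    ring
  · intro m
    have := hδ0 m
    positivity
  · intro n A B hm hB ih
    exact FF_rec A (by omega) B (δ A.card) hB (hδ0 _) (hCC n A (by omega)) ih

lemma Gnum_le (n : ℕ) : Gnum n ≤ (FF (univ : Finset (Fin n))).card := by
  unfold Gnum
  rw [← Set.ncard_coe_finset]
  refine Set.ncard_le_ncard ?_ (finite_toSet _)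
  rintro f ⟨F, -, -, hf⟩
  refine mem_coe.2 (mem_image.2 ⟨F, ?_, ?_⟩)
  · rw [mem_powerset]
    intro c _
    simp [mem_CL]
  · funext σ
    rw [Bool.eq_iff_iff, hf σ]
    simp [ev, Cs]

/-! ### The lower bound -/

/-- Graphs without isolated vertices. -/
def EE (n : ℕ) : Finset (Finset (Sym2 (Fin n))) :=
  ((univ : Finset (Fin n)).sym2.powerset).filter (fun E => ∀ i, ∃ j, i ≠ j ∧ s(i, j) ∈ E)

lemma sat_dec {n : ℕ} (E : Finset (Sym2 (Fin n))) (σ : Fin n → Bool) :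
    Sat (dec E) σ ↔ ∀ u w, u ≠ w → s(u, w) ∈ E →
      σ u = decide (s(u, u) ∈ E) ∨ σ w = decide (s(w, w) ∈ E) := by
  constructor
  · intro h u w huw hE
    exact h u w _ _ (by simp [dec, huw, hE])
  · intro h u w a b hd
    unfold dec at hd
    split_ifs at hd with hc
    simp only [Option.some.injEq, Prod.mk.injEq] at hd
    rw [← hd.1, ← hd.2]
    exact h u w hc.1 hc.2

lemma evS_dec_twoSAT {n : ℕ} (hn : 0 < n) {E : Finset (Sym2 (Fin n))} (hE : E ∈ EE n) :
    IsTwoSATFunction (evS (dec E)) := by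
  refine ⟨univ.filter (fun c => c.1.1 ≠ c.2.1 ∧ dec E c.1.1 c.2.1 = some (c.1.2, c.2.2)), ?_, ?_, ?_⟩
  · obtain ⟨j, hj, hjE⟩ := (mem_filter.1 hE).2 ⟨0, hn⟩
    refine ⟨((⟨0, hn⟩, decide (s(⟨0, hn⟩, ⟨0, hn⟩) ∈ E)), (j, decide (s(j, j) ∈ E))), ?_⟩
    simp [dec, hj, hjE]
  · intro c hc
    exact (mem_filter.1 hc).2.1
  · intro σ
    simp only [evS, decide_eq_true_eq, mem_filter, mem_univ, true_and]
    constructor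
    · intro h c hc
      exact h _ _ _ _ hc.2
    · intro h u w a b hd
      refine h ((u, a), (w, b)) ⟨?_, hd⟩
      unfold dec at hd
      split_ifs at hd with hc
      exact hc.1

lemma dec_inj {n : ℕ} {E E' : Finset (Sym2 (Fin n))} (hE : E ∈ EE n)
    (h : evS (dec E) = evS (dec E')) :
    (∀ u, s(u, u) ∈ E ↔ s(u, u) ∈ E') := by
  have hm : ∀ σ, Sat (dec E) σ ↔ Sat (dec E') σ := by
    intro σ
    have := congrFun h σ
    simpa [evS] using this
  intro u
  by_contra hne
  obtain ⟨w, huw, hw⟩ := (mem_filter.1 hE).2 u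
  have h1 : Sat (dec E') (Function.update (fun x => decide (s(x, x) ∈ E')) w
      (!decide (s(w, w) ∈ E))) := by
    rw [sat_dec]
    intro x y hxy _
    by_cases hx : x = w
    · right
      subst hx
      rw [Function.update_of_ne (Ne.symm hxy)]
    · left
      rw [Function.update_of_ne hx]
  rw [← hm, sat_dec] at h1
  rcases h1 u w huw hw with h2 | h2
  · rw [Function.update_of_ne huw] at h2
    exact hne (decide_eq_decide.1 h2).symm
  · rw [Function.update_self] at h2
    simp at h2

lemma dec_inj2 {n : ℕ} {E E' : Finset (Sym2 (Fin n))} (hE : E ∈ EE n)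
    (h : evS (dec E) = evS (dec E')) : E ⊆ E' := by
  have hd := dec_inj hE h
  have hm : ∀ σ, Sat (dec E) σ ↔ Sat (dec E') σ := by
    intro σ
    have := congrFun h σ
    simpa [evS] using this
  intro z
  induction z using Sym2.ind with
  | _ u w =>
  intro hz
  by_cases huw : u = w
  · subst huw
    exact (hd u).1 hz
  by_contra hz'
  have h1 : Sat (dec E') (fun x => if x = u ∨ x = w then !decide (s(x, x) ∈ E')
      else decide (s(x, x) ∈ E')) := by
    rw [sat_dec]
    intro x y hxy hE'
    by_cases hx : x = u ∨ x = w
    · by_cases hy : y = u ∨ y = w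
      · exfalso
        rcases hx with rfl | rfl
        · rcases hy with rfl | rfl
          · exact hxy rfl
          · exact hz' hE'
        · rcases hy with rfl | rfl
          · rw [Sym2.eq_swap] at hE'
            exact hz' hE'
          · exact hxy rfl
      · right
        simp only [if_neg hy]
    · left
      simp only [if_neg hx]
  rw [← hm, sat_dec] at h1
  rcases h1 u w huw hz with h2 | h2
  · simp [hd] at h2
  · simp [hd] at h2

lemma card_EE_le (n : ℕ) (hn : 0 < n) : (EE n).card ≤ Gnum n := by
  unfold Gnum
  rw [← Set.ncard_coe_finset]
  refine Set.ncard_le_ncard_of_injOn (fun E => evS (dec E)) ?_ ?_ (Set.toFinite _)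
  · intro E hE
    exact evS_dec_twoSAT hn hE
  · intro E hE E' hE' h
    exact Subset.antisymm (dec_inj2 hE h) (dec_inj2 hE' h.symm)

lemma card_EE (n : ℕ) (hn : 0 < n) :
    (2 : ℝ) ^ T n * (1 - 2 * (n * (1 / 2) ^ n)) ≤ (EE n).card := by
  let Z : Fin n → Finset (Sym2 (Fin n)) := fun i => (univ.erase i).image (fun j => s(i, j))
  have hZ : ∀ i, (Z i).card = n - 1 := by
    intro i
    simp only [Z]
    rw [card_image_of_injective, card_erase_of_mem (mem_univ i)]
    · simp
    · intro x y hxy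
      exact Sym2.congr_right.1 hxy
  have hcU : (univ : Finset (Fin n)).sym2.card = T n := by
    rw [card_sym2_T]; simp
  have hcover : (univ : Finset (Fin n)).sym2.powerset ⊆ EE n ∪
      (univ : Finset (Fin n)).biUnion (fun i => ((univ : Finset (Fin n)).sym2 \ Z i).powerset) := by
    intro E hE
    rw [mem_union]
    by_cases h : E ∈ EE n
    · exact Or.inl h
    right
    have h' : ¬ ∀ i, ∃ j, i ≠ j ∧ s(i, j) ∈ E := fun h2 => h (mem_filter.2 ⟨hE, h2⟩)
    push Not at h'
    obtain ⟨i, hi⟩ := h'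
    rw [mem_biUnion]
    refine ⟨i, mem_univ _, mem_powerset.2 fun z hz => mem_sdiff.2 ⟨mem_powerset.1 hE hz, ?_⟩⟩
    intro hzZ
    obtain ⟨j, hj, rfl⟩ := mem_image.1 hzZ
    exact hi j (mem_erase.1 hj).1.symm hz
  have h1 : 2 ^ T n ≤ (EE n).card + n * 2 ^ (T n - (n - 1)) := by
    have e1 := (card_le_card hcover).trans (card_union_le _ _)
    rw [card_powerset, hcU] at e1
    refine e1.trans (Nat.add_le_add_left ?_ _)
    refine (card_biUnion_le_card_mul _ _ (2 ^ (T n - (n - 1))) ?_).trans (by simp)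
    intro i _
    rw [card_powerset, card_sdiff_of_subset, hcU, hZ]
    intro z hz
    simp
  have hle : n - 1 ≤ T n := by
    unfold T
    rw [Nat.le_div_iff_mul_le (by norm_num)]
    have : n - 1 ≤ n := by omega
    nlinarith
  have h2 : (2 : ℝ) ^ T n ≤ (EE n).card + n * 2 ^ (T n - (n - 1)) := by exact_mod_cast h1
  have h3 : (2 : ℝ) ^ (T n - (n - 1)) = 2 ^ T n * (2 * (1 / 2) ^ n) := by
    obtain ⟨r, hr⟩ := Nat.exists_eq_add_of_le hle
    obtain ⟨q, rfl⟩ : ∃ q, n = q + 1 := ⟨n - 1, by omega⟩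
    have e : T (q + 1) - (q + 1 - 1) = r := by omega
    have e2 : T (q + 1) = q + r := by omega
    rw [e, e2, pow_add, pow_succ]
    have : (2 : ℝ) ^ q * (1 / 2) ^ q = 1 := by
      rw [← mul_pow]; norm_num
    linear_combination (-(2 : ℝ) ^ r) * this
  rw [h3] at h2
  linarith

theorem main_count :
    Tendsto (fun n : ℕ => (Gnum n : ℝ) / (2 : ℝ) ^ (n * (n + 1) / 2)) atTop (nhds 1) := by
  obtain ⟨m0, δ, hδ, -, hFF⟩ := FF_bound
  have hlow : Tendsto (fun n : ℕ => 1 - 2 * ((n : ℝ) * (1 / 2) ^ n)) atTop (nhds 1) := by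
    have ha : |(1 / 2 : ℝ)| < 1 := by rw [abs_of_nonneg] <;> norm_num
    have := ((tendsto_pow_const_mul_const_pow_of_abs_lt_one 1 ha).const_mul 2).const_sub 1
    simpa using this
  have hup : Tendsto (fun n : ℕ => 1 + δ n) atTop (nhds 1) := by
    simpa using hδ.const_add 1
  refine tendsto_of_tendsto_of_tendsto_of_le_of_le' hlow hup ?_ ?_
  · filter_upwards [eventually_gt_atTop 0] with n hn
    rw [le_div_iff₀ (by positivity)]
    have h1 := card_EE n hn
    have h2 : ((EE n).card : ℝ) ≤ Gnum n := by exact_mod_cast card_EE_le n hn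
    rw [mul_comm]
    exact h1.trans h2
  · filter_upwards [eventually_ge_atTop m0] with n hn
    rw [div_le_iff₀ (by positivity)]
    have h1 := hFF n univ (by simpa using hn)
    have h2 : (Gnum n : ℝ) ≤ (FF (univ : Finset (Fin n))).card := by exact_mod_cast Gnum_le n
    rw [card_univ, Fintype.card_fin] at h1
    exact h2.trans h1

end TwoSat

/-- The number of 2-SAT functions of `n` variables is `(1+o(1)) 2^{n(n+1)/2}`. -/
theorem two_sat_function_count :
    Tendsto (fun n : ℕ => (Gnum n : ℝ) / (2 : ℝ) ^ (n * (n + 1) / 2)) atTop (nhds 1) := TwoSat.main_count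
end
end

section
/- For every n, |𝓑(n)| ≤ 2^{n(n+1)/2−1}, and |𝓑(n)| = (1−o(1))·2^{n(n+1)/2−1}; that is, |𝓑(n)|/2^{n(n+1)/2−1} → 1 as n → ∞. -/
open Filter

noncomputable section

/-- A colored graph on `Fin n`: a simple graph whose edges are partitioned
into red and blue edges. -/
structure ColoredGraph (n : ℕ) where
  red : SimpleGraph (Fin n)
  blue : SimpleGraph (Fin n)
  disj : ∀ x y, ¬ (red.Adj x y ∧ blue.Adj x y)

namespace ColoredGraph

variable {n : ℕ}

/-- The underlying (uncolored) simple graph. -/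
def graph (G : ColoredGraph n) : SimpleGraph (Fin n) := G.red ⊔ G.blue

/-- Adjacency in a colored graph. -/
def Adj (G : ColoredGraph n) (x y : Fin n) : Prop := G.graph.Adj x y

/-- The neighborhood of a vertex. -/
def nbhd (G : ColoredGraph n) (x : Fin n) : Set (Fin n) := {y | G.Adj x y}

/-- `Γ(Q)`, the external neighborhood of a set of vertices. -/
def nbhdSet (G : ColoredGraph n) (Q : Set (Fin n)) : Set (Fin n) :=
  (⋃ x ∈ Q, G.nbhd x) \ Q

/-- The degree of a vertex. -/
def deg (G : ColoredGraph n) (x : Fin n) : ℕ := (G.nbhd x).ncard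

open scoped Classical in
/-- Indicator that the edge `xy` is blue. -/
def blueInd (G : ColoredGraph n) (x y : Fin n) : ℕ := if G.blue.Adj x y then 1 else 0

/-- Odd-blue-triangle-free: no triangle with an odd number of blue edges. -/
def OBTF (G : ColoredGraph n) : Prop :=
  ∀ x y z : Fin n, G.Adj x y → G.Adj y z → G.Adj x z →
    ¬ Odd (G.blueInd x y + G.blueInd y z + G.blueInd x z)

/-- The colored graph induced on the vertex set `A` is blue-bipartite: there is a
partition `U ⊔ (A \ U)` of `A` such that blue edges within `A` cross the partition
and red edges within `A` do not. -/
def BlueBipartiteOn (G : ColoredGraph n) (A : Set (Fin n)) : Prop :=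
  ∃ U ⊆ A, ∀ x ∈ A, ∀ y ∈ A,
    (G.blue.Adj x y → (x ∈ U ↔ y ∉ U)) ∧ (G.red.Adj x y → (x ∈ U ↔ y ∈ U))

/-- Blue-bipartite colored graph. -/
def BlueBipartite (G : ColoredGraph n) : Prop := G.BlueBipartiteOn Set.univ

/-- `κ(G)`: the minimum size of a vertex set whose removal leaves a blue-bipartite graph. -/
def kappa (G : ColoredGraph n) : ℕ :=
  sInf {k | ∃ K : Set (Fin n), K.ncard = k ∧ G.BlueBipartiteOn Kᶜ}

end ColoredGraph

/-- `𝓕(n)`: the set of OBTF colored graphs on `[n]`. -/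
def obtfSet (n : ℕ) : Set (ColoredGraph n) := {G | G.OBTF}

/-- `F(n) = |𝓕(n)|`. -/
def Fnum (n : ℕ) : ℕ := (obtfSet n).ncard

/-- `𝓑(n)`: the set of blue-bipartite colored graphs on `[n]`. -/
def bbSet (n : ℕ) : Set (ColoredGraph n) := {G | G.BlueBipartite}

/-- `|𝓑(n)|`. -/
def Bnum (n : ℕ) : ℕ := (bbSet n).ncard

/-- `b(n) = 2^{n(n+1)/2 - 1}`. -/
def bnum (n : ℕ) : ℕ := 2 ^ (n * (n + 1) / 2 - 1)

namespace BBCount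

open Finset

/-- Simple graphs correspond to sets of non-diagonal unordered pairs. -/
def graphEquiv (V : Type*) : SimpleGraph V ≃ Set {e : Sym2 V // ¬ e.IsDiag} where
  toFun H := {e | e.1 ∈ H.edgeSet}
  invFun S := SimpleGraph.fromEdgeSet (Subtype.val '' S)
  left_inv H := by
    ext a b
    simp only [SimpleGraph.fromEdgeSet_adj, Set.mem_image, Set.mem_ofPred_eq, Subtype.exists]
    constructor
    · rintro ⟨⟨e, he, h, rfl⟩, hab⟩
      exact h
    · intro h
      exact ⟨⟨s(a, b), by simpa using h.ne, h, rfl⟩, h.ne⟩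
  right_inv S := by
    ext ⟨e, he⟩
    induction e using Sym2.ind with
    | _ a b =>
      simp only [Set.mem_ofPred_eq, SimpleGraph.mem_edgeSet, SimpleGraph.fromEdgeSet_adj,
        Set.mem_image, Subtype.exists]
      constructor
      · rintro ⟨⟨e, he', h, rfl⟩, hab⟩
        exact h
      · intro h
        exact ⟨⟨s(a, b), he, h, rfl⟩, by simpa using he⟩

theorem card_graph (n : ℕ) : Nat.card (SimpleGraph (Fin n)) = 2 ^ (n.choose 2) := by
  classical
  rw [Nat.card_congr (graphEquiv (Fin n)), Nat.card_eq_fintype_card, Fintype.card_set,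
    Sym2.card_subtype_not_diag, Fintype.card_fin]

/-- Graphs in which `x` and `y` have no common neighbour. -/
def bad {n : ℕ} (x y : Fin n) : Set (SimpleGraph (Fin n)) :=
  {H | ∀ z, ¬ (H.Adj x z ∧ H.Adj y z)}

/-- The pairs from `x` or `y` to other vertices. -/
def emb {n : ℕ} (x y : Fin n) (p : {z : Fin n // z ≠ x ∧ z ≠ y} × Bool) :
    {e : Sym2 (Fin n) // ¬ e.IsDiag} :=
  ⟨s(if p.2 then x else y, p.1.1), by
    obtain ⟨⟨z, h1, h2⟩, b⟩ := p
    cases b <;> simp [h1.symm, h2.symm]⟩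

theorem emb_inj {n : ℕ} {x y : Fin n} (hxy : x ≠ y) : Function.Injective (emb x y) := by
  rintro ⟨⟨z, h1, h2⟩, b⟩ ⟨⟨z', h1', h2'⟩, b'⟩ h
  simp only [emb, Subtype.mk.injEq, Sym2.eq_iff] at h
  cases b <;> cases b' <;> grind

open Classical in
/-- Encoding of bad graphs. -/
def enc {n : ℕ} (x y : Fin n) (H : bad x y) :
    ({z : Fin n // z ≠ x ∧ z ≠ y} → {p : Bool × Bool // p ≠ (true, true)}) ×
      Set ((Set.range (emb x y))ᶜ : Set _) :=
  (fun z => ⟨(decide (H.1.Adj x z.1), decide (H.1.Adj y z.1)), by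
      have := H.2 z.1
      simpa using this⟩,
   {e | e.1.1 ∈ H.1.edgeSet})

theorem enc_inj {n : ℕ} (x y : Fin n) : Function.Injective (enc x y) := by
  classical
  intro H K h
  simp only [enc, Prod.mk.injEq] at h
  obtain ⟨h1, h2⟩ := h
  apply Subtype.ext
  apply (graphEquiv _).injective
  ext e
  change e.1 ∈ H.1.edgeSet ↔ e.1 ∈ K.1.edgeSet
  by_cases he : e ∈ Set.range (emb x y)
  · obtain ⟨⟨z, b⟩, rfl⟩ := he
    have := congrFun h1 z
    simp only [Subtype.mk.injEq, Prod.mk.injEq, decide_eq_decide] at this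
    cases b
    · simpa [emb] using this.2
    · simpa [emb] using this.1
  · exact Set.ext_iff.1 h2 ⟨e, he⟩

theorem bad_le {n : ℕ} {x y : Fin n} (hxy : x ≠ y) :
    Nat.card (bad x y) * 4 ^ (n - 2) ≤ 3 ^ (n - 2) * 2 ^ (n.choose 2) := by
  classical
  have hZ : Fintype.card {z : Fin n // z ≠ x ∧ z ≠ y} = n - 2 := by
    rw [Fintype.card_subtype]
    have : (univ.filter fun z : Fin n => z ≠ x ∧ z ≠ y) = ({x, y} : Finset (Fin n))ᶜ := by
      ext; simp
    rw [this, card_compl, card_pair hxy, Fintype.card_fin]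
  have hP : Fintype.card {p : Bool × Bool // p ≠ (true, true)} = 3 := by decide
  have hR : Fintype.card (Set.range (emb x y)) = (n - 2) * 2 := by
    rw [Set.card_range_of_injective (emb_inj hxy), Fintype.card_prod, hZ, Fintype.card_bool]
  have hE : Fintype.card {e : Sym2 (Fin n) // ¬ e.IsDiag} = n.choose 2 := by
    rw [Sym2.card_subtype_not_diag, Fintype.card_fin]
  have hC : Fintype.card ((Set.range (emb x y))ᶜ : Set _) + (n - 2) * 2 = n.choose 2 := by
    rw [← hE, ← hR, add_comm]
    simp only [← Nat.card_eq_fintype_card, Nat.card_coe_set_eq]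
    exact Set.ncard_add_ncard_compl _
  have h := Nat.card_le_card_of_injective _ (enc_inj x y)
  rw [Nat.card_prod, Nat.card_fun, Nat.card_eq_fintype_card (α := Set _), Fintype.card_set,
    Nat.card_eq_fintype_card (α := {p : Bool × Bool // p ≠ (true, true)}), hP,
    Nat.card_eq_fintype_card (α := {z : Fin n // z ≠ x ∧ z ≠ y}), hZ] at h
  calc _ ≤ _ := Nat.mul_le_mul_right (4 ^ (n - 2)) h
    _ = _ := by
      rw [← hC, pow_add, mul_comm (n - 2) 2, pow_mul]
      norm_num
      ring

/-- Graphs in which every vertex has a common neighbour with `0`. -/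
def good (n : ℕ) : Set (SimpleGraph (Fin (n + 1))) :=
  {H | ∀ y : Fin n, ∃ z, H.Adj 0 z ∧ H.Adj y.succ z}

theorem good_bound (n : ℕ) :
    2 ^ ((n + 1).choose 2) ≤ (good n).ncard + ∑ y : Fin n, (bad 0 y.succ).ncard := by
  classical
  have hcov : (Set.univ : Set (SimpleGraph (Fin (n + 1)))) ⊆
      good n ∪ ⋃ y ∈ (univ : Finset (Fin n)), bad 0 y.succ := by
    intro H _
    by_cases h : H ∈ good n
    · exact Or.inl h
    · right
      simp only [good, Set.mem_ofPred_eq, not_forall, not_exists] at h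
      obtain ⟨y, hy⟩ := h
      simp only [Set.mem_iUnion]
      exact ⟨y, mem_univ _, hy⟩
  have h := Set.ncard_le_ncard hcov (Set.toFinite _)
  rw [Set.ncard_univ, card_graph] at h
  exact h.trans ((Set.ncard_union_le _ _).trans
    (Nat.add_le_add_left (Finset.set_ncard_biUnion_le _ _) _))

/-- The two-colouring of vertices, with `0` coloured `false`. -/
def col {n : ℕ} (c : Fin n → Bool) : Fin (n + 1) → Bool := Fin.cons false c

/-- The coloured graph of a graph and a vertex bipartition. -/
def mk {n : ℕ} (p : SimpleGraph (Fin (n + 1)) × (Fin n → Bool)) : ColoredGraph (n + 1) where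
  red := 
    { Adj := fun a b => p.1.Adj a b ∧ col p.2 a = col p.2 b
      symm := ⟨fun _ _ h => ⟨h.1.symm, h.2.symm⟩⟩
      loopless := ⟨fun _ h => h.1.ne rfl⟩ }
  blue := 
    { Adj := fun a b => p.1.Adj a b ∧ col p.2 a ≠ col p.2 b
      symm := ⟨fun _ _ h => ⟨h.1.symm, h.2.symm⟩⟩
      loopless := ⟨fun _ h => h.1.ne rfl⟩ }
  disj := fun _ _ h => h.2.2 h.1.2

theorem range_mk (n : ℕ) : Set.range (mk (n := n)) = bbSet (n + 1) := by
  classical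
  ext G
  constructor
  · rintro ⟨p, rfl⟩
    refine ⟨{a | col p.2 a = true}, Set.subset_univ _, fun x _ y _ => ⟨?_, ?_⟩⟩
    · rintro ⟨-, h⟩
      simp only [Set.mem_ofPred_eq]
      revert h
      cases col p.2 x <;> cases col p.2 y <;> simp
    · rintro ⟨-, h⟩
      simp only [Set.mem_ofPred_eq, h]
  · rintro ⟨U, -, hU⟩
    have key : ∀ a, col (fun i : Fin n => decide (¬ (i.succ ∈ U ↔ (0 : Fin (n + 1)) ∈ U))) a =
        decide (¬ (a ∈ U ↔ (0 : Fin (n + 1)) ∈ U)) := by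
      intro a
      refine Fin.cases ?_ (fun i => ?_) a
      · simp [col]
      · simp [col]
    refine ⟨(G.graph, fun i => decide (¬ (i.succ ∈ U ↔ (0 : Fin (n + 1)) ∈ U))), ?_⟩
    obtain ⟨r, b, d⟩ := G
    simp only [mk, ColoredGraph.mk.injEq, key]
    constructor
    · ext x y
      have h1 := (hU x trivial y trivial).1
      have h2 := (hU x trivial y trivial).2
      simp only [ColoredGraph.graph, SimpleGraph.sup_adj, decide_eq_decide] at *
      tauto
    · ext x y
      have h1 := (hU x trivial y trivial).1
      have h2 := (hU x trivial y trivial).2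
      simp only [ColoredGraph.graph, SimpleGraph.sup_adj, ne_eq, decide_eq_decide] at *
      tauto

theorem card_dom (n : ℕ) : Nat.card (SimpleGraph (Fin (n + 1)) × (Fin n → Bool)) =
    2 ^ ((n + 1).choose 2) * 2 ^ n := by
  rw [Nat.card_prod, card_graph]
  simp

theorem upper (n : ℕ) : Bnum (n + 1) ≤ 2 ^ ((n + 1).choose 2) * 2 ^ n := by
  rw [Bnum, ← range_mk, ← card_dom, ← Set.image_univ, ← Set.ncard_univ]
  exact Set.ncard_image_le (Set.toFinite _)

theorem mk_injOn (n : ℕ) : Set.InjOn (mk (n := n)) (good n ×ˢ Set.univ) := by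
  rintro ⟨H, c⟩ ⟨hH, -⟩ ⟨K, d⟩ ⟨hK, -⟩ h
  have hr : ∀ a b, (H.Adj a b ∧ col c a = col c b) ↔ (K.Adj a b ∧ col d a = col d b) := by
    intro a b
    have := congrArg (fun G => G.red.Adj a b) h
    simpa [mk] using this
  have hb : ∀ a b, (H.Adj a b ∧ col c a ≠ col c b) ↔ (K.Adj a b ∧ col d a ≠ col d b) := by
    intro a b
    have := congrArg (fun G => G.blue.Adj a b) h
    simpa [mk] using this
  have hHK : H = K := by
    ext a b
    have := hr a b
    have := hb a b
    tauto
  subst hHK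
  congr 1
  funext y
  obtain ⟨z, h0, hy⟩ := hH y
  replace h0 : H.Adj 0 z := h0
  replace hy : H.Adj y.succ z := hy
  have e1 := hr 0 z
  have e2 := hr y.succ z
  simp only [h0, hy, true_and] at e1 e2
  have c0 : col c 0 = false := rfl
  have d0 : col d 0 = false := rfl
  have cy : col c y.succ = c y := by simp [col]
  have dy : col d y.succ = d y := by simp [col]
  rw [c0, d0] at e1
  rw [cy, dy] at e2
  revert e1 e2
  cases col c z <;> cases col d z <;> cases c y <;> cases d y <;> simp

theorem lower (n : ℕ) : (good n).ncard * 2 ^ n ≤ Bnum (n + 1) := by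
  have h : (mk '' (good n ×ˢ (Set.univ : Set (Fin n → Bool)))).ncard = (good n).ncard * 2 ^ n := by
    rw [(mk_injOn n).ncard_image, Set.ncard_prod, Set.ncard_univ]
    simp
  rw [← h, Bnum, ← range_mk]
  exact Set.ncard_le_ncard (Set.image_subset_range _ _) (Set.toFinite _)

theorem expo (n : ℕ) : (n + 1) * (n + 1 + 1) / 2 - 1 = (n + 1).choose 2 + n := by
  have h1 : (n + 1 + 1).choose 2 = (n + 1) * (n + 1 + 1) / 2 := by
    rw [Nat.choose_two_right, mul_comm]; rfl
  have h2 : (n + 1 + 1).choose 2 = (n + 1).choose 1 + (n + 1).choose 2 := rfl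
  rw [Nat.choose_one_right] at h2
  omega

theorem bad_real (n : ℕ) (y : Fin n) : ((bad 0 y.succ).ncard : ℝ) ≤
    4 / 3 * (3 / 4) ^ n * 2 ^ ((n + 1).choose 2) := by
  obtain ⟨m, rfl⟩ : ∃ m, n = m + 1 := ⟨n - 1, by have := y.2; omega⟩
  have h := bad_le (x := 0) (y := y.succ) (Fin.succ_ne_zero y).symm
  rw [Nat.card_coe_set_eq] at h
  have h' : (((bad 0 y.succ).ncard : ℝ)) * 4 ^ m ≤ 3 ^ m * 2 ^ ((m + 1 + 1).choose 2) := by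
    exact_mod_cast h
  have e : 4 / 3 * (3 / 4 : ℝ) ^ (m + 1) * 2 ^ ((m + 1 + 1).choose 2) =
      3 ^ m * 2 ^ ((m + 1 + 1).choose 2) / 4 ^ m := by
    rw [pow_succ, div_pow]
    ring
  rw [e, le_div_iff₀ (by positivity)]
  exact h'

theorem lower_real (n : ℕ) : 1 - 4 / 3 * ((n : ℝ) * (3 / 4) ^ n) ≤
    (Bnum (n + 1) : ℝ) / (2 : ℝ) ^ ((n + 1) * (n + 1 + 1) / 2 - 1) := by
  rw [expo, le_div_iff₀ (by positivity), pow_add]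
  have h1 : (2 : ℝ) ^ ((n + 1).choose 2) ≤
      (good n).ncard + ∑ y : Fin n, ((bad 0 y.succ).ncard : ℝ) := by
    exact_mod_cast good_bound n
  have h2 : ∑ y : Fin n, ((bad 0 y.succ).ncard : ℝ) ≤
      n * (4 / 3 * (3 / 4) ^ n * 2 ^ ((n + 1).choose 2)) := by
    refine (Finset.sum_le_sum fun y _ => bad_real n y).trans ?_
    simp
  have h3 : ((good n).ncard : ℝ) * 2 ^ n ≤ Bnum (n + 1) := by exact_mod_cast lower n
  refine le_trans ?_ h3
  rw [← mul_assoc]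
  refine mul_le_mul_of_nonneg_right ?_ (by positivity)
  linarith

theorem upper' (n : ℕ) : Bnum n ≤ 2 ^ (n * (n + 1) / 2 - 1) := by
  cases n with
  | zero =>
    have : Subsingleton (ColoredGraph 0) := ⟨by
      rintro ⟨r, b, d⟩ ⟨r', b', d'⟩
      have h1 : r = r' := by ext a; exact a.elim0
      have h2 : b = b' := by ext a; exact a.elim0
      subst h1 h2
      rfl⟩
    simpa [Bnum] using Set.ncard_le_one_of_subsingleton (bbSet 0)
  | succ n =>
    rw [expo, pow_add]
    exact upper n

end BBCount

theorem blue_bipartite_count :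
    (∀ n : ℕ, Bnum n ≤ 2 ^ (n * (n + 1) / 2 - 1)) ∧
    Tendsto (fun n : ℕ => (Bnum n : ℝ) / (2 : ℝ) ^ (n * (n + 1) / 2 - 1)) atTop (nhds 1) := by
  refine ⟨BBCount.upper', ?_⟩
  rw [← tendsto_add_atTop_iff_nat 1]
  have h : Tendsto (fun n : ℕ => (1 : ℝ) - 4 / 3 * ((n : ℝ) * (3 / 4) ^ n)) atTop (nhds 1) := by
    have := tendsto_self_mul_const_pow_of_lt_one (r := (3 / 4 : ℝ)) (by norm_num) (by norm_num)
    simpa using (this.const_mul (4 / 3)).const_sub 1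
  refine tendsto_of_tendsto_of_tendsto_of_le_of_le h tendsto_const_nhds
    (fun n => BBCount.lower_real n) (fun n => ?_)
  show (Bnum (n + 1) : ℝ) / _ ≤ 1
  rw [div_le_one (by positivity)]
  exact_mod_cast BBCount.upper' (n + 1)
end
end
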